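/- arXiv:1305.4262 — 2 statements merged into one kernel-verified Lean document; each statement's English description precedes it below -/
import Mathlib

section
/- Let n ≥ 2. There exists a constant C > 0 such that for every u ∈ C_c^∞(ℝⁿ; ℝⁿ), ∫_{ℝⁿ} |Du(x)| / |x| dx ≤ C ∫_{ℝⁿ} ( |Δu(x)| + |∇(div u)(x)| ) dx. -/
open MeasureTheory ENNReal
open scoped NNReal RealInnerProductSpace

noncomputable section

/-- A homogeneous linear differential operator `A(D)` of order `k` from `V` to `E` on a
Euclidean space `X`, represented through its action `u ↦ A (D^k u)` on the `k`-th
iterated (Fréchet) derivative; this is equivalent to the data of a family of coefficients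
`(A_α)_{|α| = k}`, `A_α ∈ 𝓛(V; E)`, acting by `A(D)u = ∑_{|α|=k} A_α (∂^α u)`. -/
abbrev DiffOperator (X : Type*) [NormedAddCommGroup X] [InnerProductSpace ℝ X]
    (k : ℕ) (V E : Type*) [NormedAddCommGroup V] [NormedSpace ℝ V]
    [NormedAddCommGroup E] [NormedSpace ℝ E] :=
  ContinuousMultilinearMap ℝ (fun _ : Fin k => X) V →L[ℝ] E

namespace DiffOperator

variable {X : Type*} [NormedAddCommGroup X] [InnerProductSpace ℝ X]
  {k : ℕ} {V E : Type*} [NormedAddCommGroup V] [NormedSpace ℝ V]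
  [NormedAddCommGroup E] [NormedSpace ℝ E]

/-- The action `A(D)u` of the differential operator on a function `u : X → V`. -/
noncomputable def app (A : DiffOperator X k V E) (u : X → V) (x : X) : E :=
  A (iteratedFDeriv ℝ k u x)

/-- The symbol `A(ξ) = ∑_{|α|=k} ξ^α A_α ∈ 𝓛(V; E)` of the operator: it sends `v : V` to
`A` applied to the `k`-linear map `(w₁, …, w_k) ↦ (⟪ξ,w₁⟫ ⋯ ⟪ξ,w_k⟫) • v`. -/
noncomputable def symbol (A : DiffOperator X k V E) (ξ : X) : V →L[ℝ] E :=
  A.comp (((ContinuousMultilinearMap.compContinuousLinearMapL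
      (fun _ : Fin k => innerSL ℝ ξ)).comp
    (ContinuousMultilinearMap.piFieldEquiv ℝ (Fin k)
      V).toContinuousLinearEquiv.toContinuousLinearMap))

/-- `A(D)` is elliptic if its symbol `A(ξ)` is injective for every `ξ ≠ 0`. -/
def IsElliptic (A : DiffOperator X k V E) : Prop :=
  ∀ ξ : X, ξ ≠ 0 → Function.Injective (A.symbol ξ)

/-- `A(D)` is canceling if `⋂_{ξ ≠ 0} A(ξ)[V] = {0}`. -/
def IsCanceling (A : DiffOperator X k V E) : Prop :=
  (⋂ (ξ : X) (_ : ξ ≠ 0), Set.range (A.symbol ξ)) = {0}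

end DiffOperator

/-- `u ∈ C_c^∞`: a smooth compactly supported function. -/
def IsTestFun {X V : Type*} [NormedAddCommGroup X] [NormedSpace ℝ X]
    [NormedAddCommGroup V] [NormedSpace ℝ V] (u : X → V) : Prop :=
  ContDiff ℝ (⊤ : ℕ∞) u ∧ HasCompactSupport u

namespace MazHardy

abbrev EE (n : ℕ) := EuclideanSpace ℝ (Fin n)

lemma polar {n : ℕ} (hn : 2 ≤ n) (f : ℝ → ℝ) (hf : ∀ r, 0 ≤ r → 0 ≤ f r)
    (hi : IntegrableOn (fun y : ℝ => y ^ (n - 1) * f y) (Set.Ioi 0)) :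
    ∫⁻ x : EE n, ENNReal.ofReal (f ‖x‖) =
      ENNReal.ofReal (n * (volume.real (Metric.ball (0 : EE n) 1)) *
        ∫ y in Set.Ioi (0 : ℝ), y ^ (n - 1) * f y) := by
  have : Nonempty (Fin n) := ⟨⟨0, by omega⟩⟩
  have : Nontrivial (EE n) := inferInstance
  have hd : Module.finrank ℝ (EE n) = n := by simp
  have h1 : Integrable (fun x : EE n => f ‖x‖) volume := by
    rw [integrable_fun_norm_addHaar]
    simpa [hd] using hi
  rw [← ofReal_integral_eq_lintegral_ofReal h1 (Filter.Eventually.of_forall fun x => hf _ (norm_nonneg x))]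
  rw [integral_fun_norm_addHaar]
  simp [hd, mul_assoc]

lemma J1 {n : ℕ} (hn : 2 ≤ n) (R : ℝ) (hR : 0 < R) :
    ∫⁻ x : EE n, ENNReal.ofReal (if ‖x‖ < R then ‖x‖ / ‖x‖ ^ n else 0) =
      ENNReal.ofReal (n * (volume.real (Metric.ball (0 : EE n) 1)) * R) := by
  have key : ∀ y ∈ Set.Ioi (0:ℝ), y ^ (n - 1) * (if y < R then y / y ^ n else 0)
      = (Set.Iio R).indicator (fun _ => (1:ℝ)) y := by
    intro y hy
    have hy : 0 < y := hy
    by_cases h : y < R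
    · simp only [h, if_true, Set.indicator, Set.mem_Iio]
      obtain ⟨m, rfl⟩ : ∃ m, n = m + 1 := ⟨n - 1, by omega⟩
      simp only [Nat.add_sub_cancel]
      field_simp
      ring
    · simp [h]
  rw [polar hn (fun r => if r < R then r / r ^ n else 0)]
  · congr 2
    rw [setIntegral_congr_fun measurableSet_Ioi key, setIntegral_indicator measurableSet_Iio]
    have : Set.Ioi (0:ℝ) ∩ Set.Iio R = Set.Ioo 0 R := rfl
    rw [this]; simp [hR.le]
  · intro r h
    split_ifs
    · positivity
    · exact le_rfl
  · rw [integrableOn_congr_fun key measurableSet_Ioi]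
    rw [IntegrableOn, integrable_indicator_iff measurableSet_Iio]
    rw [IntegrableOn, Measure.restrict_restrict measurableSet_Iio]
    have : Set.Iio R ∩ Set.Ioi (0:ℝ)  = Set.Ioo 0 R := by ext; simp [and_comm]
    rw [this]
    exact integrableOn_const (by simp)

lemma J2 {n : ℕ} (hn : 2 ≤ n) (R : ℝ) (hR : 0 < R) :
    ∫⁻ x : EE n, ENNReal.ofReal (if R ≤ ‖x‖ then 1 / ‖x‖ ^ (n + 1) else 0) =
      ENNReal.ofReal (n * (volume.real (Metric.ball (0 : EE n) 1)) * (1 / R)) := by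
  have key : ∀ y ∈ Set.Ioi (0:ℝ), y ^ (n - 1) * (if R ≤ y then 1 / y ^ (n + 1) else 0)
      = (Set.Ici R).indicator (fun y => y ^ (-2:ℝ)) y := by
    intro y hy
    have hy : 0 < y := hy
    by_cases h : R ≤ y
    · simp only [h, if_true, Set.indicator, Set.mem_Ici]
      obtain ⟨m, rfl⟩ : ∃ m, n = m + 1 := ⟨n - 1, by omega⟩
      simp only [Nat.add_sub_cancel]
      rw [Real.rpow_neg hy.le]
      norm_cast
      field_simp
      ring
    · simp [h]
  have hs : Set.Ici R ∩ Set.Ioi (0:ℝ) = Set.Ici R := by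
    ext x; simp only [Set.mem_inter_iff, Set.mem_Ici, Set.mem_Ioi]
    constructor
    · exact fun h => h.1
    · exact fun h => ⟨h, lt_of_lt_of_le hR h⟩
  rw [polar hn (fun r => if R ≤ r then 1 / r ^ (n + 1) else 0)]
  · congr 2
    rw [setIntegral_congr_fun measurableSet_Ioi key, setIntegral_indicator measurableSet_Ici,
      Set.inter_comm, hs, integral_Ici_eq_integral_Ioi, integral_Ioi_rpow_of_lt (by norm_num) hR]
    norm_num [Real.rpow_neg_one]
  · intro r _
    split_ifs with h
    · have : 0 < r := lt_of_lt_of_le hR h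
      positivity
    · exact le_rfl
  · rw [integrableOn_congr_fun key measurableSet_Ioi]
    rw [IntegrableOn, integrable_indicator_iff measurableSet_Ici]
    rw [IntegrableOn, Measure.restrict_restrict measurableSet_Ici, hs]
    exact (integrableOn_Ici_iff_integrableOn_Ioi).2 (integrableOn_Ioi_rpow_of_lt (by norm_num) hR)

/-- the weight -/
def W (n : ℕ) (x y : EE n) : ℝ :=
  if ‖x‖ < 2 * ‖y‖ then (1 / ‖y‖) * (‖x‖ / ‖x‖ ^ n + ‖x - y‖ / ‖x - y‖ ^ n)
  else ‖y‖ / ‖x‖ ^ (n + 1)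

lemma W_nonneg (n : ℕ) (x y : EE n) : 0 ≤ W n x y := by
  unfold W; split_ifs <;> positivity

lemma W_meas (n : ℕ) : Measurable (fun p : EE n × EE n => W n p.1 p.2) := by
  unfold W
  apply Measurable.ite
  · exact measurableSet_lt (by fun_prop) (by fun_prop)
  · fun_prop
  · fun_prop

lemma W_int {n : ℕ} (hn : 2 ≤ n) (y : EE n) :
    ∫⁻ x, ENNReal.ofReal (W n x y) ≤
      ENNReal.ofReal (7 * (n * (volume.real (Metric.ball (0 : EE n) 1)))) := by
  set ω : ℝ := n * (volume.real (Metric.ball (0 : EE n) 1)) with hω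
  have hω0 : 0 ≤ ω := by positivity
  by_cases hy : y = 0
  · subst hy
    have : ∀ x, W n x 0 = 0 := by
      intro x; unfold W; simp
    simp [this]
  have hs : 0 < ‖y‖ := norm_pos_iff.2 hy
  set F : ℝ → ℝ := fun r => if r < 3 * ‖y‖ then r / r ^ n else 0
  set G : ℝ → ℝ := fun r => if 2 * ‖y‖ ≤ r then 1 / r ^ (n+1) else 0
  have hF : ∀ x : EE n, 0 ≤ F ‖x‖ := fun x => by simp only [F]; split_ifs <;> positivity
  have hG : ∀ x : EE n, 0 ≤ G ‖x‖ := fun x => by simp only [G]; split_ifs <;> positivity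
  have hle : ∀ x, W n x y ≤ (1 / ‖y‖) * F ‖x‖ + (1 / ‖y‖) * F ‖x - y‖ + ‖y‖ * G ‖x‖ := by
    intro x
    have h1 := hF x
    have h2 := hF (x - y)
    have h3 := hG x
    unfold W
    split_ifs with h
    · have h4 : ‖x‖ < 3 * ‖y‖ := by linarith
      have h5 : ‖x - y‖ < 3 * ‖y‖ := by linarith [norm_sub_le x y]
      have h6 : ¬ (2 * ‖y‖ ≤ ‖x‖) := by linarith
      simp only [F, G, h4, h5, h6, if_true, if_false]
      linarith
    · have : G ‖x‖ = 1 / ‖x‖ ^ (n+1) := by simp only [G]; rw [if_pos (by linarith)]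
      have h7 : 0 ≤ (1 / ‖y‖) * F ‖x‖ := by positivity
      have h8 : 0 ≤ (1 / ‖y‖) * F ‖x - y‖ := by positivity
      rw [this]
      rw [mul_one_div]; linarith
  have mF : Measurable F := Measurable.ite measurableSet_Iio (by fun_prop) (by fun_prop)
  have mG : Measurable G := Measurable.ite measurableSet_Ici (by fun_prop) (by fun_prop)
  have i1 : ∫⁻ x : EE n, ENNReal.ofReal (F ‖x‖) = ENNReal.ofReal (ω * (3 * ‖y‖)) :=
    J1 hn _ (by positivity)
  have i2 : ∫⁻ x : EE n, ENNReal.ofReal (F ‖x - y‖) = ENNReal.ofReal (ω * (3 * ‖y‖)) := by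
    rw [← i1]
    exact lintegral_sub_right_eq_self (fun x : EE n => ENNReal.ofReal (F ‖x‖)) y
  have i3 : ∫⁻ x : EE n, ENNReal.ofReal (G ‖x‖) = ENNReal.ofReal (ω * (1 / (2 * ‖y‖))) :=
    J2 hn _ (by positivity)
  have m1 : Measurable fun x : EE n => ENNReal.ofReal (F ‖x‖) := by fun_prop
  have m2 : Measurable fun x : EE n => ENNReal.ofReal (F ‖x - y‖) := by fun_prop
  have m3 : Measurable fun x : EE n => ENNReal.ofReal (G ‖x‖) := by fun_prop
  calc ∫⁻ x, ENNReal.ofReal (W n x y)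
      ≤ ∫⁻ x, (ENNReal.ofReal (1 / ‖y‖) * ENNReal.ofReal (F ‖x‖) +
          ENNReal.ofReal (1 / ‖y‖) * ENNReal.ofReal (F ‖x - y‖) +
          ENNReal.ofReal ‖y‖ * ENNReal.ofReal (G ‖x‖)) := by
        refine lintegral_mono fun x => ?_
        have h1 := hF x
        have h2 := hF (x - y)
        have h3 := hG x
        rw [← ENNReal.ofReal_mul (by positivity), ← ENNReal.ofReal_mul (by positivity),
          ← ENNReal.ofReal_mul (by positivity), ← ENNReal.ofReal_add (by positivity)
          (by positivity), ← ENNReal.ofReal_add (by positivity) (by positivity)]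
        exact ENNReal.ofReal_le_ofReal (hle x)
    _ = ENNReal.ofReal (1 / ‖y‖) * ENNReal.ofReal (ω * (3 * ‖y‖)) +
          ENNReal.ofReal (1 / ‖y‖) * ENNReal.ofReal (ω * (3 * ‖y‖)) +
          ENNReal.ofReal ‖y‖ * ENNReal.ofReal (ω * (1 / (2 * ‖y‖))) := by
        rw [lintegral_add_left (by fun_prop), lintegral_add_left (by fun_prop),
          lintegral_const_mul _ m1, lintegral_const_mul _ m2, lintegral_const_mul _ m3,
          i1, i2, i3]
    _ ≤ _ := by
        rw [← ENNReal.ofReal_mul (by positivity),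
          ← ENNReal.ofReal_mul (by positivity), ← ENNReal.ofReal_add (by positivity)
          (by positivity), ← ENNReal.ofReal_add (by positivity) (by positivity)]
        apply ENNReal.ofReal_le_ofReal
        have e1 : 1 / ‖y‖ * (ω * (3 * ‖y‖)) = 3 * ω := by field_simp
        have e2 : ‖y‖ * (ω * (1 / (2 * ‖y‖))) = ω / 2 := by field_simp
        rw [e1, e2]; linarith


/-- the regularised kernel density -/
def S (n : ℕ) (ε : ℝ) (z : EE n) : ℝ := (‖z‖ ^ 2 + ε ^ 2) ^ (-(n : ℝ) / 2)

def K (n : ℕ) (ε : ℝ) (j : Fin n) (z : EE n) : ℝ := z j * S n ε z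

lemma S_pos (n : ℕ) {ε : ℝ} (hε : 0 < ε) (z : EE n) : 0 < S n ε z :=
  Real.rpow_pos_of_pos (by positivity) _

lemma S_le (n : ℕ) {ε : ℝ} (z : EE n) (hz : z ≠ 0) : S n ε z ≤ 1 / ‖z‖ ^ n := by
  have h0 : 0 < ‖z‖ := norm_pos_iff.2 hz
  have : (1:ℝ) / ‖z‖ ^ n = (‖z‖ ^ 2) ^ (-(n : ℝ) / 2) := by
    rw [← Real.rpow_natCast ‖z‖ 2, ← Real.rpow_mul h0.le]
    rw [show ((2:ℕ):ℝ) * (-(n:ℝ) / 2) = -(n:ℝ) by push_cast; ring, Real.rpow_neg h0.le,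
      Real.rpow_natCast, one_div]
  rw [this]
  apply Real.rpow_le_rpow_of_nonpos (by positivity) (by nlinarith [sq_nonneg ε])
  have : (0:ℝ) ≤ n := by positivity
  linarith

lemma abs_coord {n : ℕ} (z : EE n) (j : Fin n) : |z j| ≤ ‖z‖ := by
  simpa using PiLp.norm_apply_le z j

lemma K_le (n : ℕ) {ε : ℝ} (hε : 0 < ε) (j : Fin n) (z : EE n) :
    |K n ε j z| ≤ ‖z‖ / ‖z‖ ^ n := by
  by_cases hz : z = 0
  · subst hz; simp [K]
  unfold K
  rw [abs_mul, abs_of_pos (S_pos n hε z), div_eq_mul_one_div]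
  exact mul_le_mul (abs_coord z j) (S_le n z hz) (S_pos n hε z).le (norm_nonneg _)

lemma S_hasFDerivAt (n : ℕ) {ε : ℝ} (hε : 0 < ε) (z : EE n) :
    HasFDerivAt (S n ε) ((-(n : ℝ) * S n ε z / (‖z‖ ^ 2 + ε ^ 2)) • innerSL ℝ z) z := by
  have hq : 0 < ‖z‖ ^ 2 + ε ^ 2 := by positivity
  have h1 : HasFDerivAt (fun z : EE n => ‖z‖ ^ 2 + ε ^ 2) (2 • innerSL ℝ z) z :=
    ((hasStrictFDerivAt_norm_sq z).hasFDerivAt).add_const _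
  have h2 : HasFDerivAt (S n ε) _ z := h1.rpow_const (p := -(n : ℝ) / 2) (Or.inl hq.ne')
  refine h2.congr_fderiv ?_
  rw [Real.rpow_sub_one hq.ne']
  ext v
  simp [S]
  ring

lemma S_contDiff (n : ℕ) {ε : ℝ} (hε : 0 < ε) : ContDiff ℝ (⊤ : ℕ∞) (S n ε) := by
  unfold S
  apply ContDiff.rpow_const_of_ne
  · exact (contDiff_norm_sq ℝ).add contDiff_const
  · intro x; positivity

lemma coord_contDiff {n : ℕ} (j : Fin n) : ContDiff ℝ (⊤ : ℕ∞) (fun z : EE n => z j) := by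
  fun_prop

lemma K_contDiff (n : ℕ) {ε : ℝ} (hε : 0 < ε) (j : Fin n) :
    ContDiff ℝ (⊤ : ℕ∞) (K n ε j) :=
  (coord_contDiff j).mul (S_contDiff n hε)

lemma coord_hasFDerivAt {n : ℕ} (j : Fin n) (z : EE n) :
    HasFDerivAt (fun z : EE n => z j) (EuclideanSpace.proj j : EE n →L[ℝ] ℝ) z :=
  (EuclideanSpace.proj j : EE n →L[ℝ] ℝ).hasFDerivAt

lemma K_fderiv (n : ℕ) {ε : ℝ} (hε : 0 < ε) (j : Fin n) (z v : EE n) :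
    fderiv ℝ (K n ε j) z v =
      S n ε z * v j - n * S n ε z * z j * inner ℝ z v / (‖z‖ ^ 2 + ε ^ 2) := by
  have h := (coord_hasFDerivAt j z).mul (S_hasFDerivAt n hε z)
  have h' : fderiv ℝ (K n ε j) z = _ := h.fderiv
  rw [h']
  simp
  ring

lemma K_fderiv_norm (n : ℕ) {ε : ℝ} (hε : 0 < ε) (j : Fin n) (z : EE n) :
    ‖fderiv ℝ (K n ε j) z‖ ≤ (1 + n) * S n ε z := by
  have hS := S_pos n hε z
  refine ContinuousLinearMap.opNorm_le_bound _ (by positivity) fun v => ?_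
  rw [K_fderiv n hε, Real.norm_eq_abs]
  have hq : 0 < ‖z‖ ^ 2 + ε ^ 2 := by positivity
  have h1 : |S n ε z * v j| ≤ S n ε z * ‖v‖ := by
    rw [abs_mul, abs_of_pos hS]; gcongr; exact abs_coord v j
  have h2 : |n * S n ε z * z j * inner ℝ z v / (‖z‖ ^ 2 + ε ^ 2)| ≤ n * S n ε z * ‖v‖ := by
    rw [abs_div, abs_of_pos hq, div_le_iff₀ hq, abs_mul, abs_mul, abs_mul, abs_of_pos hS,
      abs_of_nonneg (by positivity : (0:ℝ) ≤ n)]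
    calc n * S n ε z * |z j| * |inner ℝ z v| ≤ n * S n ε z * ‖z‖ * (‖z‖ * ‖v‖) := by
          gcongr
          · exact abs_coord z j
          · exact abs_real_inner_le_norm z v
      _ = n * S n ε z * ‖v‖ * ‖z‖ ^ 2 := by ring
      _ ≤ _ := by gcongr; nlinarith [sq_nonneg ε]
  calc _ ≤ _ := abs_sub _ _
    _ ≤ _ := add_le_add h1 h2
    _ = _ := by ring

lemma K_diff (n : ℕ) {ε : ℝ} (hε : 0 < ε) (j : Fin n) (x y : EE n) (hx : x ≠ 0)
    (h : 2 * ‖y‖ ≤ ‖x‖) :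
    |K n ε j (x - y) - K n ε j x| ≤ 2 ^ n * (1 + n) * (‖y‖ / ‖x‖ ^ n) := by
  have h0 : 0 < ‖x‖ := norm_pos_iff.2 hx
  have hb : ∀ z ∈ Metric.closedBall x (‖x‖ / 2),
      ‖fderiv ℝ (K n ε j) z‖ ≤ 2 ^ n * (1 + n) / ‖x‖ ^ n := by
    intro z hz
    rw [mem_closedBall_iff_norm] at hz
    have h1 : ‖x‖ / 2 ≤ ‖z‖ := by
      have := norm_sub_norm_le x z
      rw [norm_sub_rev] at this
      linarith
    have hz0 : 0 < ‖z‖ := by linarith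
    calc _ ≤ _ := K_fderiv_norm n hε j z
      _ ≤ (1 + n) * (1 / ‖z‖ ^ n) := by gcongr; exact S_le n z (norm_pos_iff.1 hz0)
      _ ≤ (1 + n) * (1 / (‖x‖ / 2) ^ n) := by gcongr
      _ = _ := by rw [div_pow]; field_simp
  have := (convex_closedBall x (‖x‖ / 2)).norm_image_sub_le_of_norm_fderiv_le
    (fun z _ => ((K_contDiff n hε j).differentiable (by simp)).differentiableAt) hb
    (x := x) (y := x - y) (by simp; positivity) (by simp; linarith)
  rw [Real.norm_eq_abs] at this
  refine this.trans (le_of_eq ?_)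
  simp
  ring

def Cn (n : ℕ) : ℝ := 2 ^ n * (1 + n) + 4 * (n + 2) + 4

/-- cutoff -/
def ph (n : ℕ) (r : ℝ) (y : EE n) : ℝ := r ^ 2 / (r ^ 2 + ‖y‖ ^ 2)

def M (n : ℕ) (r : ℝ) (y : EE n) : ℝ := 2 * r ^ 2 * ‖y‖ ^ 2 / (r ^ 2 + ‖y‖ ^ 2) ^ 2

lemma ptwise {n : ℕ} (hn : 2 ≤ n) {ε : ℝ} (hε : 0 < ε) (j : Fin n) (x y : EE n) (hx : x ≠ 0) :
    |K n ε j (x - y) - K n ε j x * ph n ‖x‖ y| + ‖x‖ / ‖x‖ ^ n * ((n + 2) * M n ‖x‖ y) ≤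
      Cn n * (‖x‖ * W n x y) := by
  have hW := W_nonneg n x y
  have hKx := K_le n hε j x
  have hKxy := K_le n hε j (x - y)
  set r := ‖x‖ with hr
  set s := ‖y‖ with hs
  set t := ‖x - y‖ with ht
  have h0 : 0 < r := norm_pos_iff.2 hx
  have hs0 : 0 ≤ s := norm_nonneg _
  have ht0 : 0 ≤ t := norm_nonneg _
  have hrn : 0 < r ^ n := by positivity
  by_cases h : r < 2 * s
  · have hsp : 0 < s := by linarith
    have hWe : r * W n x y = r / s * (r / r ^ n + t / t ^ n) := by
      unfold W; rw [if_pos h]; simp only [← hr, ← hs, ← ht]; ring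
    have e1 : ph n r y ≤ 2 * (r / s) := by
      unfold ph; rw [← hs, ← mul_div_assoc, div_le_div_iff₀ (by positivity) hsp]
      nlinarith [mul_pos h0 hsp, pow_pos h0 3, mul_pos (mul_pos h0 hsp) h0, mul_pos (mul_pos h0 hsp) hsp]
    have e1' : 0 ≤ ph n r y := by unfold ph; positivity
    have e2 : M n r y ≤ 4 * (r / s) := by
      have : M n r y ≤ 2 * ph n r y := by
        unfold M ph
        rw [← hs, div_le_iff₀ (by positivity)]
        have : 2 * (r ^ 2 / (r ^ 2 + s ^ 2)) * (r ^ 2 + s ^ 2) ^ 2 = 2 * r ^ 2 * (r ^ 2 + s ^ 2) := by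
          field_simp
        rw [this]
        nlinarith [pow_pos h0 2, pow_pos h0 4]
      linarith
    have e3 : t / t ^ n ≤ 2 * (r / s * (r / r ^ n + t / t ^ n)) := by
      by_cases h2 : s ≤ 2 * r
      · have a1 : 1 ≤ 2 * (r / s) := by rw [← mul_div_assoc, le_div_iff₀ hsp]; linarith
        have a2 : 0 ≤ t / t ^ n := by positivity
        have a3 : 0 ≤ r / s * (r / r ^ n) := by positivity
        nlinarith
      · have h3 : s / 2 ≤ t := by
          have := norm_sub_norm_le y x
          rw [norm_sub_rev] at this
          linarith
        obtain ⟨m, rfl⟩ : ∃ m, n = m + 2 := ⟨n - 2, by omega⟩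
        have htp : 0 < t := by linarith
        have a1 : t / t ^ (m + 2) = 1 / t ^ (m + 1) := by field_simp; ring
        have a2 : r / r ^ (m + 2) = 1 / r ^ (m + 1) := by field_simp; ring
        have a3 : 1 / t ^ (m + 1) ≤ 1 / (s / 2) ^ (m + 1) := by gcongr
        have a4 : 1 / (s / 2) ^ (m + 1) ≤ 2 * (r / s * (1 / r ^ (m + 1))) := by
          have : 2 * (r / s * (1 / r ^ (m + 1))) = 1 / ((s / 2) * r ^ m) := by
            field_simp; ring
          rw [this, pow_succ']
          gcongr
          linarith
        have a5 : 0 ≤ r / s * (t / t ^ (m + 2)) := by positivity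
        calc t / t ^ (m + 2) ≤ 2 * (r / s * (1 / r ^ (m + 1))) := by rw [a1]; exact a3.trans a4
          _ ≤ _ := by rw [← a2]; nlinarith
    rw [hWe]
    have b0 : |K n ε j (x - y) - K n ε j x * ph n r y| ≤ t / t ^ n + r / r ^ n * (2 * (r / s)) := by
      refine (abs_sub _ _).trans ?_
      rw [abs_mul, abs_of_nonneg e1']
      gcongr
    have b1 : r / r ^ n * ((n + 2) * M n r y) ≤ r / r ^ n * ((n + 2) * (4 * (r / s))) := by
      gcongr
    have b2 : 0 ≤ r / s * (t / t ^ n) := by positivity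
    have b3 : 0 ≤ r / s * (r / r ^ n) := by positivity
    set A := r / s * (t / t ^ n)
    set B := r / s * (r / r ^ n) with hB
    have b4 : r / r ^ n * (2 * (r / s)) = 2 * B := by rw [hB]; ring
    have b5 : r / r ^ n * ((n + 2) * (4 * (r / s))) = 4 * (n + 2) * B := by rw [hB]; ring
    have b6 : r / s * (r / r ^ n + t / t ^ n) = B + A := by ring
    rw [b6] at e3 ⊢
    have b7 : 0 ≤ (2:ℝ) ^ n * (1 + n) * (B + A) := by positivity
    have b8 : 0 ≤ 4 * ((n:ℝ) + 2) * A := by positivity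
    unfold Cn
    nlinarith
  · push Not at h
    have hWe : r * W n x y = s / r ^ n := by
      unfold W; rw [if_neg (by simpa using h)]; simp only [← hr, ← hs]; field_simp
      ring
    rw [hWe]
    have d1 := K_diff n hε j x y hx h
    rw [← hs, ← hr] at d1
    have e1 : 1 - ph n r y ≤ s / r := by
      unfold ph; rw [← hs]
      have : 1 - r ^ 2 / (r ^ 2 + s ^ 2) = s ^ 2 / (r ^ 2 + s ^ 2) := by field_simp; ring
      rw [this, div_le_div_iff₀ (by positivity) h0]
      nlinarith [mul_nonneg h0.le hs0, mul_nonneg (mul_nonneg h0.le hs0) hs0, mul_nonneg (mul_nonneg h0.le hs0) h0.le, pow_nonneg hs0 3]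
    have e1' : 0 ≤ 1 - ph n r y := by
      unfold ph
      rw [sub_nonneg, div_le_one (by positivity)]; nlinarith
    have e2 : M n r y ≤ 2 * (s / r) := by
      have : M n r y ≤ 2 * (1 - ph n r y) := by
        unfold M ph
        rw [← hs, div_le_iff₀ (by positivity)]
        have : 2 * (1 - r ^ 2 / (r ^ 2 + s ^ 2)) * (r ^ 2 + s ^ 2) ^ 2 = 2 * s ^ 2 * (r ^ 2 + s ^ 2) := by
          field_simp; ring
        rw [this]
        nlinarith [pow_nonneg hs0 4]
      linarith
    have b0 : |K n ε j (x - y) - K n ε j x * ph n r y| ≤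
        2 ^ n * (1 + n) * (s / r ^ n) + r / r ^ n * (s / r) := by
      have : K n ε j (x - y) - K n ε j x * ph n r y =
        (K n ε j (x - y) - K n ε j x) + K n ε j x * (1 - ph n r y) := by ring
      rw [this]
      refine (abs_add_le _ _).trans ?_
      rw [abs_mul, abs_of_nonneg e1']
      gcongr
    have b1 : r / r ^ n * ((n + 2) * M n r y) ≤ r / r ^ n * ((n + 2) * (2 * (s / r))) := by
      gcongr
    have b3 : r / r ^ n * (s / r) = s / r ^ n := by field_simp
    have b4 : r / r ^ n * ((n + 2) * (2 * (s / r))) = 2 * (n + 2) * (s / r ^ n) := by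
      rw [← b3]; ring
    have b5 : 0 ≤ s / r ^ n := by positivity
    have b6 : 0 ≤ (n : ℝ) * (s / r ^ n) := by positivity
    rw [b3] at b0
    rw [b4] at b1
    have b7 : Cn n * (s / r ^ n) = 2 ^ n * (1 + n) * (s / r ^ n) + 4 * (n * (s / r ^ n))
        + 12 * (s / r ^ n) := by unfold Cn; ring
    rw [b7]
    have b8 : 2 * ((n:ℝ) + 2) * (s / r ^ n) = 2 * (n * (s / r ^ n)) + 4 * (s / r ^ n) := by ring
    rw [b8] at b1
    linarith

/-- partial derivative -/
def D {n : ℕ} (i : Fin n) (w : EE n → ℝ) : EE n → ℝ :=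
  fun y => fderiv ℝ w y (EuclideanSpace.single i (1 : ℝ))

def Sm {n : ℕ} (w : EE n → ℝ) : Prop := ContDiff ℝ (⊤ : ℕ∞) w

def Te {n : ℕ} (w : EE n → ℝ) : Prop := Sm w ∧ HasCompactSupport w

section calc_lemmas
variable {n : ℕ}

lemma Sm.diff {w : EE n → ℝ} (h : Sm w) : Differentiable ℝ w := ContDiff.differentiable h (by simp)

lemma Sm.cont {w : EE n → ℝ} (h : Sm w) : Continuous w := ContDiff.continuous h

lemma Sm.D {w : EE n → ℝ} (h : Sm w) (i : Fin n) : Sm (D i w) := by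
  unfold Sm MazHardy.D
  exact ContDiff.clm_apply (ContDiff.fderiv_right (m := (⊤ : ℕ∞)) h (by simp)) contDiff_const

lemma Te.D {w : EE n → ℝ} (h : Te w) (i : Fin n) : Te (D i w) :=
  ⟨h.1.D i, h.2.fderiv_apply ℝ _⟩

lemma Te.sum {w : Fin n → EE n → ℝ} (h : ∀ i, Te (w i)) : Te (fun y => ∑ i, w i y) := by
  constructor
  · exact ContDiff.sum fun i _ => (h i).1
  · have : (fun y => ∑ i, w i y) = ∑ i, w i := by ext; simp
    rw [this]
    classical
    refine Finset.sum_induction w HasCompactSupport (fun a b ha hb => ha.add hb) ?_ fun i _ => (h i).2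
    exact HasCompactSupport.zero

lemma Te.sub {v w : EE n → ℝ} (hv : Te v) (hw : Te w) : Te (fun y => v y - w y) :=
  ⟨ContDiff.sub hv.1 hw.1, hv.2.sub hw.2⟩

lemma Te.int {a w : EE n → ℝ} (ha : Sm a) (hw : Te w) : Integrable (fun y => a y * w y) :=
  (ha.cont.mul hw.1.cont).integrable_of_hasCompactSupport hw.2.mul_left

lemma D_comm {w : EE n → ℝ} (h : Sm w) (i j : Fin n) : D i (D j w) = D j (D i w) := by
  have key : ∀ i j : Fin n, ∀ y, D i (D j w) y = fderiv ℝ (fderiv ℝ w) y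
      (EuclideanSpace.single i (1:ℝ)) (EuclideanSpace.single j (1:ℝ)) := by
    intro i j y
    have hd : DifferentiableAt ℝ (fderiv ℝ w) y :=
      ((ContDiff.fderiv_right (m := (⊤ : ℕ∞)) h (by simp)).differentiable (by simp)) y
    unfold D
    rw [fderiv_clm_apply hd (differentiableAt_const _)]
    simp
  ext y
  rw [key, key]
  exact (ContDiffAt.isSymmSndFDerivAt (n := (⊤ : ℕ∞)) (ContDiff.contDiffAt h) (by simp; exact WithTop.coe_le_coe.2 (le_top : (2 : ℕ∞) ≤ ⊤))) _ _

lemma D_sum {w : Fin n → EE n → ℝ} (h : ∀ i, Sm (w i)) (k : Fin n) :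
    D k (fun y => ∑ i, w i y) = fun y => ∑ i, D k (w i) y := by
  ext y
  unfold D
  rw [fderiv_fun_sum fun i _ => (h i).diff y]
  simp

lemma D_mul {a b : EE n → ℝ} (ha : Sm a) (hb : Sm b) (k : Fin n) (y : EE n) :
    D k (fun y => a y * b y) y = D k a y * b y + a y * D k b y := by
  unfold D
  rw [fderiv_fun_mul (ha.diff y) (hb.diff y)]
  simp
  ring

lemma D_sub {a b : EE n → ℝ} (ha : Sm a) (hb : Sm b) (k : Fin n) (y : EE n) :
    D k (fun y => a y - b y) y = D k a y - D k b y := by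
  unfold D
  rw [fderiv_fun_sub (ha.diff y) (hb.diff y)]
  simp

lemma D_coord (i k : Fin n) (y : EE n) : D k (fun y : EE n => y i) y = if i = k then 1 else 0 := by
  unfold D
  rw [(coord_hasFDerivAt i y).fderiv]
  simp

lemma ibp {a w : EE n → ℝ} (ha : Sm a) (hw : Te w) (i : Fin n) :
    ∫ y, a y * D i w y = - ∫ y, D i a y * w y :=
  integral_mul_fderiv_eq_neg_fderiv_mul_of_integrable (Te.int (ha.D i) hw) (Te.int ha (hw.D i))
    (Te.int ha hw) (fun x _ => ha.diff x) (fun x _ => hw.1.diff x)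

/-- swapping derivatives -/
lemma swap {a w : EE n → ℝ} (ha : Sm a) (hw : Te w) (i j : Fin n) :
    ∫ y, D i a y * D j w y = ∫ y, D j a y * D i w y := by
  have h1 := ibp ha (hw.D j) i
  have h2 := ibp ha (hw.D i) j
  rw [D_comm hw.1 i j] at h1
  linarith

lemma rep (a : Fin n → EE n → ℝ) (ha : ∀ i, Sm (a i)) (hs : ∀ i j, D i (a j) = D j (a i))
    {w : EE n → ℝ} (hw : Te w) (j : Fin n) :
    ∫ y, a j y * ∑ i, D i (D i w) y = - ∫ y, (∑ i, D i (a i) y) * D j w y := by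
  have h1 : ∫ y, a j y * ∑ i, D i (D i w) y = ∑ i, ∫ y, a j y * D i (D i w) y := by
    simp_rw [Finset.mul_sum]
    exact integral_finsetSum _ fun i _ => Te.int (ha j) ((hw.D i).D i)
  have h2 : ∫ y, (∑ i, D i (a i) y) * D j w y = ∑ i, ∫ y, D i (a i) y * D j w y := by
    simp_rw [Finset.sum_mul]
    exact integral_finsetSum _ fun i _ => Te.int ((ha i).D i) (hw.D j)
  rw [h1, h2, ← Finset.sum_neg_distrib]
  refine Finset.sum_congr rfl fun i _ => ?_
  rw [ibp (ha j) (hw.D i), hs i j, swap (ha i) hw]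

def lap (U : EE n → ℝ) : EE n → ℝ := fun y => ∑ i, D i (D i U) y

def dv (U : Fin n → EE n → ℝ) : EE n → ℝ := fun y => ∑ i, D i (U i) y

lemma lap_Te {w : EE n → ℝ} (h : Te w) : Te (lap w) := Te.sum fun i => (h.D i).D i

lemma dv_Te {U : Fin n → EE n → ℝ} (h : ∀ i, Te (U i)) : Te (dv U) := Te.sum fun i => (h i).D i

lemma divfree {U : Fin n → EE n → ℝ} (h : ∀ i, Te (U i)) (y : EE n) :
    ∑ k, D k (fun y => lap (U k) y - D k (dv U) y) y = 0 := by
  have h1 : ∀ k, D k (fun y => lap (U k) y - D k (dv U) y) y =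
      ∑ i, D k (D i (D i (U k))) y - ∑ i, D k (D k (D i (U i))) y := by
    intro k
    rw [D_sub (lap_Te (h k)).1 ((dv_Te h).D k).1]
    unfold lap dv
    rw [D_sum (fun i => (((h k).D i).D i).1), D_sum (fun i => ((h i).D i).1),
      D_sum (fun i => (((h i).D i).D k).1)]
  simp_rw [h1]
  rw [Finset.sum_sub_distrib, Finset.sum_comm, sub_eq_zero]
  refine Finset.sum_congr rfl fun i _ => Finset.sum_congr rfl fun k _ => ?_
  rw [D_comm ((h k).D i).1 k i, D_comm (h k).1 k i]

def Bt (U : Fin n → EE n → ℝ) (p : EE n → ℝ) (i j : Fin n) (y : EE n) : ℝ :=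
  y i * D j p y * D i (dv U) y - y i * D i p y * D j (dv U) y
    - ∑ k, y j * D k p y * (lap (U k) y - D k (dv U) y)

lemma Sm.mul {a b : EE n → ℝ} (ha : Sm a) (hb : Sm b) : Sm (fun y => a y * b y) :=
  ContDiff.mul ha hb

lemma Bt_int {U : Fin n → EE n → ℝ} (h : ∀ i, Te (U i)) {p : EE n → ℝ} (hp : Sm p)
    (i j : Fin n) : Integrable (Bt U p i j) := by
  unfold Bt
  refine ((Te.int ((coord_contDiff i : Sm _).mul (hp.D j)) ((dv_Te h).D i)).sub
    (Te.int ((coord_contDiff i : Sm _).mul (hp.D i)) ((dv_Te h).D j))).sub ?_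
  exact integrable_finsetSum _ fun k _ =>
    (Te.int ((coord_contDiff j : Sm _).mul (hp.D k)) ((lap_Te (h k)).sub ((dv_Te h).D k)))

lemma moment {U : Fin n → EE n → ℝ} (h : ∀ i, Te (U i)) {p : EE n → ℝ} (hp : Sm p)
    (i j : Fin n) (hij : i ≠ j) :
    ∫ y, (p y * lap (U j) y - Bt U p i j y) = 0 := by
  have hd := dv_Te h
  set ps : Fin n → EE n → ℝ := fun i y => y i * p y with hps
  have hpsm : ∀ i, Sm (ps i) := fun i => (coord_contDiff i : Sm _).mul hp
  have hD : ∀ i k y, D k (ps i) y = (if i = k then 1 else 0) * p y + y i * D k p y := by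
    intro i k y
    rw [← D_coord i k y]
    exact D_mul (coord_contDiff i) hp k y
  have hh : ∀ k, Te (fun y => lap (U k) y - D k (dv U) y) := fun k => (lap_Te (h k)).sub (hd.D k)
  have e : ∀ y, p y * lap (U j) y - Bt U p i j y =
      (D i (ps i) y * D j (dv U) y - D j (ps i) y * D i (dv U) y)
      + ∑ k, D k (ps j) y * (lap (U k) y - D k (dv U) y) := by
    intro y
    simp_rw [hD, add_mul, Finset.sum_add_distrib]
    simp [Bt, hij]
    ring
  simp_rw [e]
  have i1 : Integrable (fun y => D i (ps i) y * D j (dv U) y) := Te.int ((hpsm i).D i) (hd.D j)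
  have i2 : Integrable (fun y => D j (ps i) y * D i (dv U) y) := Te.int ((hpsm i).D j) (hd.D i)
  have i3 : ∀ k, Integrable (fun y => D k (ps j) y * (lap (U k) y - D k (dv U) y)) :=
    fun k => Te.int ((hpsm j).D k) (hh k)
  have i12 : Integrable (fun y => D i (ps i) y * D j (dv U) y - D j (ps i) y * D i (dv U) y) :=
    i1.sub i2
  rw [integral_add i12 (integrable_finsetSum _ fun k _ => i3 k), integral_sub i1 i2,
    swap (hpsm i) hd, sub_self, zero_add, integral_finsetSum _ fun k _ => i3 k]
  have e2 : ∀ k, ∫ y, D k (ps j) y * (lap (U k) y - D k (dv U) y) =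
      - ∫ y, ps j y * D k (fun y => lap (U k) y - D k (dv U) y) y := by
    intro k
    rw [ibp (hpsm j) (hh k) k, neg_neg]
  simp_rw [e2]
  rw [Finset.sum_neg_distrib, ← integral_finsetSum _ fun k _ => Te.int (hpsm j) ((hh k).D k)]
  simp_rw [← Finset.mul_sum, divfree h]
  simp

end calc_lemmas

lemma ph_Sm (n : ℕ) {r : ℝ} (hr : 0 < r) : Sm (ph n r) := by
  unfold Sm ph
  refine ContDiff.div contDiff_const (contDiff_const.add (contDiff_norm_sq ℝ)) ?_
  intro x; positivity

lemma ph_D (n : ℕ) {r : ℝ} (hr : 0 < r) (k : Fin n) (y : EE n) :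
    D k (ph n r) y = - (2 * r ^ 2 * y k) / (r ^ 2 + ‖y‖ ^ 2) ^ 2 := by
  have hq : r ^ 2 + ‖y‖ ^ 2 ≠ 0 := by positivity
  have h1 : HasFDerivAt (fun z : EE n => r ^ 2 + ‖z‖ ^ 2) (2 • innerSL ℝ y) y :=
    ((hasStrictFDerivAt_norm_sq y).hasFDerivAt).const_add _
  have h2 : HasFDerivAt (ph n r) _ y :=
    ((hasDerivAt_inv hq).comp_hasFDerivAt y h1).const_mul (r ^ 2)
  unfold D
  rw [h2.fderiv]
  simp [EuclideanSpace.inner_single_right]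
  field_simp

lemma ph_bound (n : ℕ) {r : ℝ} (hr : 0 < r) (i k : Fin n) (y : EE n) :
    |y i * D k (ph n r) y| ≤ M n r y := by
  rw [ph_D n hr, M, mul_div_assoc', abs_div, abs_of_pos (a := (r ^ 2 + ‖y‖ ^ 2) ^ 2) (by positivity)]
  gcongr
  rw [abs_mul, abs_neg, abs_mul, abs_of_pos (a := 2 * r ^ 2) (by positivity)]
  have h1 := abs_coord y i
  have h2 := abs_coord y k
  calc |y i| * (2 * r ^ 2 * |y k|) ≤ ‖y‖ * (2 * r ^ 2 * ‖y‖) := by gcongr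
    _ = _ := by ring

lemma Bt_bound {n : ℕ} {U : Fin n → EE n → ℝ} {r : ℝ} (hr : 0 < r) (i j : Fin n)
    (y : EE n) (G : ℝ) (h1 : ∀ k, |lap (U k) y| + |D k (dv U) y| ≤ G) :
    |Bt U (ph n r) i j y| ≤ (n + 2) * M n r y * G := by
  have hM : 0 ≤ M n r y := by unfold M; positivity
  have h2 : ∀ k, |D k (dv U) y| ≤ G := fun k => by linarith [h1 k, abs_nonneg (lap (U k) y)]
  have h3 : ∀ k, |lap (U k) y - D k (dv U) y| ≤ G := fun k => (abs_sub _ _).trans (h1 k)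
  unfold Bt
  have b : ∀ a b : Fin n, ∀ c : ℝ, |c| ≤ G → |y a * D b (ph n r) y * c| ≤ M n r y * G := by
    intro a b c hc
    rw [abs_mul]
    exact mul_le_mul (ph_bound n hr a b y) hc (abs_nonneg _) hM
  have s1 : |∑ k, y j * D k (ph n r) y * (lap (U k) y - D k (dv U) y)| ≤ n * (M n r y * G) := by
    refine (Finset.abs_sum_le_sum_abs _ _).trans ?_
    refine (Finset.sum_le_sum fun k _ => b j k _ (h3 k)).trans ?_
    simp
  refine (abs_sub _ _).trans ?_
  have s2 := (abs_sub (y i * D j (ph n r) y * D i (dv U) y) (y i * D i (ph n r) y * D j (dv U) y))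
  have s3 := b i j _ (h2 i)
  have s4 := b i i _ (h2 j)
  have : (n + 2) * M n r y * G = n * (M n r y * G) + 2 * (M n r y * G) := by ring
  linarith

lemma Ka_Sm {n : ℕ} {ε : ℝ} (hε : 0 < ε) (j : Fin n) (x : EE n) :
    Sm (fun y => K n ε j (x - y)) :=
  (K_contDiff n hε j).comp (contDiff_const.sub contDiff_id)

lemma Ka_D {n : ℕ} {ε : ℝ} (hε : 0 < ε) (i j : Fin n) (x y : EE n) :
    D i (fun y => K n ε j (x - y)) y =
      - (S n ε (x - y) * (if i = j then 1 else 0) -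
        n * S n ε (x - y) * (x - y) j * (x - y) i / (‖x - y‖ ^ 2 + ε ^ 2)) := by
  have h1 : HasFDerivAt (K n ε j) (fderiv ℝ (K n ε j) (x - y)) (x - y) :=
    ((K_contDiff n hε j).differentiable (by simp) _).hasFDerivAt
  have h2 : HasFDerivAt (fun y : EE n => x - y) (-(ContinuousLinearMap.id ℝ (EE n))) y :=
    (hasFDerivAt_id y).const_sub x
  have h3 : HasFDerivAt (fun y => K n ε j (x - y)) _ y := h1.comp y h2
  unfold D
  rw [h3.fderiv]
  simp only [ContinuousLinearMap.comp_neg, ContinuousLinearMap.comp_id]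
  rw [neg_apply, K_fderiv n hε]
  simp [EuclideanSpace.inner_single_right, eq_comm]

lemma Ka_sum {n : ℕ} {ε : ℝ} (hε : 0 < ε) (x y : EE n) :
    ∑ i, D i (fun y => K n ε i (x - y)) y =
      - (n * (ε ^ 2 * (‖x - y‖ ^ 2 + ε ^ 2) ^ (-((n : ℝ) + 2) / 2))) := by
  simp_rw [Ka_D hε]
  set z := x - y
  have hq : 0 < ‖z‖ ^ 2 + ε ^ 2 := by positivity
  have hz : ‖z‖ ^ 2 = ∑ i, z i * z i := by
    rw [EuclideanSpace.norm_sq_eq]; simp [sq]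
  have e : (‖z‖ ^ 2 + ε ^ 2) ^ (-((n : ℝ) + 2) / 2) = S n ε z / (‖z‖ ^ 2 + ε ^ 2) := by
    rw [S, ← Real.rpow_sub_one hq.ne']; congr 1; ring
  rw [Finset.sum_neg_distrib, Finset.sum_sub_distrib, e]
  have e2 : ∑ i, n * S n ε z * z i * z i / (‖z‖ ^ 2 + ε ^ 2) =
      n * S n ε z * ‖z‖ ^ 2 / (‖z‖ ^ 2 + ε ^ 2) := by
    rw [hz, Finset.mul_sum, Finset.sum_div]
    refine Finset.sum_congr rfl fun i _ => by ring
  rw [e2]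
  simp
  field_simp
  ring

def Ph (n : ℕ) (z : EE n) : ℝ := (1 + ‖z‖ ^ 2) ^ (-((n : ℝ) + 2) / 2)

lemma Ph_scale {n : ℕ} {c : ℝ} (hc : 0 < c) (z : EE n) :
    c ^ n * Ph n (c • z) = c⁻¹ ^ 2 * (‖z‖ ^ 2 + c⁻¹ ^ 2) ^ (-((n : ℝ) + 2) / 2) := by
  have hq : 0 < ‖z‖ ^ 2 + c⁻¹ ^ 2 := by positivity
  have e1 : 1 + ‖c • z‖ ^ 2 = c ^ 2 * (‖z‖ ^ 2 + c⁻¹ ^ 2) := by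
    rw [norm_smul, Real.norm_eq_abs, mul_pow, sq_abs]; field_simp; ring
  rw [Ph, e1, Real.mul_rpow (by positivity) hq.le, ← mul_assoc]
  congr 1
  rw [← Real.rpow_natCast c 2, ← Real.rpow_mul hc.le,
    show ((2:ℕ):ℝ) * (-((n:ℝ) + 2) / 2) = -((n + 2 : ℕ) : ℝ) by push_cast; ring,
    Real.rpow_neg hc.le, Real.rpow_natCast]
  field_simp
  ring

lemma Ph_pos {n : ℕ} (z : EE n) : 0 < Ph n z := Real.rpow_pos_of_pos (by positivity) _

lemma Ph_int (n : ℕ) : Integrable (Ph n) :=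
  integrable_rpow_neg_one_add_norm_sq (E := EE n) (r := (n : ℝ) + 2) (by simp)

lemma Ph_cont (n : ℕ) : Continuous (Ph n) := by
  unfold Ph
  refine Continuous.rpow_const (by fun_prop) fun x => Or.inl (by positivity)

lemma Ph_int_pos (n : ℕ) : 0 < ∫ z, Ph n z := by
  rw [integral_pos_iff_support_of_nonneg (fun z => (Ph_pos z).le) (Ph_int n)]
  have : Function.support (Ph n) = Set.univ := by
    ext z; simp [(Ph_pos z).ne']
  rw [this]
  exact Measure.measure_univ_pos.2 (NeZero.ne _)

lemma Ph_decay {n : ℕ} (hn : 2 ≤ n) : Filter.Tendsto (fun x : EE n => ‖x‖ ^ n * Ph n x)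
    (Bornology.cobounded (EE n)) (nhds 0) := by
  have h1 : Filter.Tendsto (fun x : EE n => (‖x‖ ^ 2)⁻¹) (Bornology.cobounded (EE n)) (nhds 0) := by
    refine Filter.Tendsto.inv_tendsto_atTop ?_
    exact (Filter.tendsto_pow_atTop (by norm_num)).comp tendsto_norm_cobounded_atTop
  refine squeeze_zero (fun x => ?_) (fun x => ?_) h1
  · have := Ph_pos x; positivity
  by_cases hx : x = 0
  · subst hx
    have : n ≠ 0 := by omega
    simp [this]
  have h0 : 0 < ‖x‖ := norm_pos_iff.2 hx
  have h2 : Ph n x ≤ 1 / ‖x‖ ^ (n + 2) := by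
    have : (1:ℝ) / ‖x‖ ^ (n + 2) = (‖x‖ ^ 2) ^ (-((n : ℝ) + 2) / 2) := by
      rw [← Real.rpow_natCast ‖x‖ 2, ← Real.rpow_mul h0.le]
      rw [show ((2:ℕ):ℝ) * (-((n:ℝ) + 2) / 2) = -((n + 2 : ℕ) : ℝ) by push_cast; ring,
        Real.rpow_neg h0.le, Real.rpow_natCast, one_div]
    rw [this]
    apply Real.rpow_le_rpow_of_nonpos (by positivity) (by nlinarith)
    have : (0:ℝ) ≤ n := by positivity
    linarith
  calc ‖x‖ ^ n * Ph n x ≤ ‖x‖ ^ n * (1 / ‖x‖ ^ (n + 2)) := by gcongr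
    _ = _ := by field_simp; ring

lemma eps_bound {n : ℕ} (hn : 2 ≤ n) {U : Fin n → EE n → ℝ} (h : ∀ i, Te (U i)) {G : EE n → ℝ}
    (hG : ∀ y k, |lap (U k) y| + |D k (dv U) y| ≤ G y) {ε : ℝ} (hε : 0 < ε) (j k : Fin n)
    (x : EE n) (hx : x ≠ 0) :
    ENNReal.ofReal |∫ y, K n ε j (x - y) * lap (U k) y| ≤
      ∫⁻ y, ENNReal.ofReal (Cn n * (‖x‖ * W n x y) * G y) := by
  have hr : 0 < ‖x‖ := norm_pos_iff.2 hx
  have : Nontrivial (Fin n) := Fin.nontrivial_iff_two_le.2 hn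
  obtain ⟨i, hik⟩ := exists_ne k
  have hp := ph_Sm n hr
  have i1 := Te.int (Ka_Sm hε j x) (lap_Te (h k))
  have i2 : Integrable (fun y => ph n ‖x‖ y * lap (U k) y - Bt U (ph n ‖x‖) i k y) :=
    (Te.int hp (lap_Te (h k))).sub (Bt_int h hp i k)
  have e : ∫ y, K n ε j (x - y) * lap (U k) y =
      ∫ y, (K n ε j (x - y) * lap (U k) y -
        K n ε j x * (ph n ‖x‖ y * lap (U k) y - Bt U (ph n ‖x‖) i k y)) := by
    rw [integral_sub i1 (i2.const_mul _), integral_const_mul, moment h hp i k hik]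
    simp
  rw [e, ← Real.norm_eq_abs, ofReal_norm]
  refine (enorm_integral_le_lintegral_enorm _).trans (lintegral_mono fun y => ?_)
  rw [← ofReal_norm, Real.norm_eq_abs]
  apply ENNReal.ofReal_le_ofReal
  have hL : |lap (U k) y| ≤ G y := by linarith [hG y k, abs_nonneg (D k (dv U) y)]
  have hG0 : 0 ≤ G y := (abs_nonneg _).trans hL
  have hB := Bt_bound hr i k y (G y) (hG y)
  have hM : 0 ≤ M n ‖x‖ y := by unfold M; positivity
  have e2 : K n ε j (x - y) * lap (U k) y -
        K n ε j x * (ph n ‖x‖ y * lap (U k) y - Bt U (ph n ‖x‖) i k y) =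
      (K n ε j (x - y) - K n ε j x * ph n ‖x‖ y) * lap (U k) y
        + K n ε j x * Bt U (ph n ‖x‖) i k y := by ring
  rw [e2]
  calc _ ≤ |K n ε j (x - y) - K n ε j x * ph n ‖x‖ y| * |lap (U k) y|
        + |K n ε j x| * |Bt U (ph n ‖x‖) i k y| := by
        rw [← abs_mul, ← abs_mul]; exact abs_add_le _ _
    _ ≤ |K n ε j (x - y) - K n ε j x * ph n ‖x‖ y| * G y
        + ‖x‖ / ‖x‖ ^ n * ((n + 2) * M n ‖x‖ y * G y) := by
        gcongr
        exact K_le n hε j x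
    _ = (|K n ε j (x - y) - K n ε j x * ph n ‖x‖ y|
        + ‖x‖ / ‖x‖ ^ n * ((n + 2) * M n ‖x‖ y)) * G y := by ring
    _ ≤ _ := by
        gcongr
        exact ptwise hn hε j x y hx

lemma lim_bound {n : ℕ} (hn : 2 ≤ n) {U : Fin n → EE n → ℝ} (h : ∀ i, Te (U i)) {G : EE n → ℝ}
    (hG : ∀ y k, |lap (U k) y| + |D k (dv U) y| ≤ G y) (j k : Fin n)
    (x : EE n) (hx : x ≠ 0) :
    ENNReal.ofReal ((∫ z, Ph n z) * |D j (U k) x|) ≤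
      ∫⁻ y, ENNReal.ofReal (Cn n * (‖x‖ * W n x y) * G y) := by
  set c0 := ∫ z, Ph n z with hc0
  have hc0p : 0 < c0 := Ph_int_pos n
  have hw := (h k).D j
  have hwi : Integrable (D j (U k)) := hw.1.cont.integrable_of_hasCompactSupport hw.2
  have hd : Module.finrank ℝ (EE n) = n := by simp
  have T := tendsto_integral_comp_smul_smul_of_integrable' (μ := (volume : Measure (EE n)))
    (φ := fun z => Ph n z / c0)
    (fun z => div_nonneg (Ph_pos z).le hc0p.le) (by rw [integral_div, ← hc0, div_self hc0p.ne'])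
    (by
      rw [hd]
      have := (Ph_decay hn).div_const c0
      simpa [mul_div_assoc] using this) hwi (x₀ := x) hw.1.cont.continuousAt
  rw [hd] at T
  have T2 : Filter.Tendsto (fun c : ℝ => ENNReal.ofReal (c0 * |∫ y, (c ^ n * (Ph n (c • (x - y)) / c0)) • D j (U k) y|))
      Filter.atTop (nhds (ENNReal.ofReal (c0 * |D j (U k) x|))) :=
    (ENNReal.continuous_ofReal.tendsto _).comp ((T.abs).const_mul c0)
  refine le_of_tendsto T2 ?_
  filter_upwards [Filter.eventually_gt_atTop 0] with c hc
  have hε : 0 < c⁻¹ := inv_pos.2 hc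
  refine le_trans ?_ (eps_bound hn h hG hε j k x hx)
  apply ENNReal.ofReal_le_ofReal
  have hrep := rep (fun i y => K n c⁻¹ i (x - y)) (fun i => Ka_Sm hε i x)
    (by
      intro i j; ext y
      rw [Ka_D hε, Ka_D hε]
      simp only [eq_comm (a := i) (b := j)]
      ring) (h k) j
  have e : ∫ y, K n c⁻¹ j (x - y) * lap (U k) y =
      n * (c0 * ∫ y, (c ^ n * (Ph n (c • (x - y)) / c0)) • D j (U k) y) := by
    have : ∫ y, K n c⁻¹ j (x - y) * lap (U k) y = _ := hrep
    rw [this, ← integral_const_mul, ← integral_const_mul, ← integral_neg]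
    refine integral_congr_ae (Filter.Eventually.of_forall fun y => ?_)
    simp only
    rw [Ka_sum hε, ← Ph_scale hc, smul_eq_mul]
    field_simp
  rw [e, abs_mul, abs_mul, abs_of_pos hc0p]
  have h1 : (1:ℝ) ≤ |(n:ℝ)| := by
    rw [abs_of_nonneg (by positivity)]
    exact_mod_cast (by omega : 1 ≤ n)
  exact le_mul_of_one_le_left (by positivity) h1

lemma Cn_pos (n : ℕ) : 0 < Cn n := by unfold Cn; positivity

lemma one_bound {n : ℕ} (hn : 2 ≤ n) {U : Fin n → EE n → ℝ} (h : ∀ i, Te (U i)) {G : EE n → ℝ}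
    (hGm : Measurable G)
    (hG : ∀ y k, |lap (U k) y| + |D k (dv U) y| ≤ G y) (j k : Fin n) :
    ∫⁻ x, ENNReal.ofReal |D j (U k) x| / ‖x‖ₑ ≤
      ENNReal.ofReal ((∫ z, Ph n z)⁻¹ * (Cn n * (7 * (n * (volume.real (Metric.ball (0 : EE n) 1))))))
        * ∫⁻ y, ENNReal.ofReal (G y) := by
  set c0 := ∫ z, Ph n z with hc0
  have hc0p : 0 < c0 := Ph_int_pos n
  set ω : ℝ := n * (volume.real (Metric.ball (0 : EE n) 1)) with hω
  have hω0 : 0 ≤ ω := by positivity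
  have hC := Cn_pos n
  have : Nonempty (Fin n) := ⟨j⟩
  have hae : ∀ᵐ x : EE n, x ≠ 0 := by
    have : Nontrivial (EE n) := inferInstance
    exact Measure.ae_ne volume 0
  have hWm : Measurable fun p : EE n × EE n => ENNReal.ofReal (W n p.1 p.2) * ENNReal.ofReal (G p.2) :=
    (W_meas n).ennreal_ofReal.mul (hGm.comp measurable_snd).ennreal_ofReal
  have hG0 : ∀ y, 0 ≤ G y := fun y => by
    have := hG y j
    exact le_trans (by positivity) this
  calc ∫⁻ x, ENNReal.ofReal |D j (U k) x| / ‖x‖ₑ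
      ≤ ∫⁻ x, ENNReal.ofReal (c0⁻¹ * Cn n) *
          ∫⁻ y, ENNReal.ofReal (W n x y) * ENNReal.ofReal (G y) := by
        refine lintegral_mono_ae ?_
        filter_upwards [hae] with x hx
        have hr : 0 < ‖x‖ := norm_pos_iff.2 hx
        have key := lim_bound hn h hG j k x hx
        rw [← ofReal_norm, ← ENNReal.ofReal_div_of_pos hr]
        have e1 : |D j (U k) x| / ‖x‖ = (c0⁻¹ * ‖x‖⁻¹) * (c0 * |D j (U k) x|) := by
          field_simp
        have e2 : ∀ y, ENNReal.ofReal (Cn n * (‖x‖ * W n x y) * G y) =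
            ENNReal.ofReal (Cn n * ‖x‖) * (ENNReal.ofReal (W n x y) * ENNReal.ofReal (G y)) := by
          intro y
          have := W_nonneg n x y
          rw [← ENNReal.ofReal_mul this, ← ENNReal.ofReal_mul (by positivity)]
          congr 1; ring
        simp_rw [e2] at key
        rw [lintegral_const_mul' _ _ ENNReal.ofReal_ne_top] at key
        rw [e1, ENNReal.ofReal_mul (by positivity)]
        calc _ ≤ ENNReal.ofReal (c0⁻¹ * ‖x‖⁻¹) * (ENNReal.ofReal (Cn n * ‖x‖) *
              ∫⁻ y, ENNReal.ofReal (W n x y) * ENNReal.ofReal (G y)) := by gcongr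
          _ = _ := by
            rw [← mul_assoc, ← ENNReal.ofReal_mul (by positivity)]
            congr 2; field_simp
    _ = ENNReal.ofReal (c0⁻¹ * Cn n) *
          ∫⁻ y, ∫⁻ x, ENNReal.ofReal (W n x y) * ENNReal.ofReal (G y) := by
        rw [lintegral_const_mul' _ _ ENNReal.ofReal_ne_top, lintegral_lintegral_swap hWm.aemeasurable]
    _ ≤ ENNReal.ofReal (c0⁻¹ * Cn n) *
          ∫⁻ y, ENNReal.ofReal (7 * ω) * ENNReal.ofReal (G y) := by
        gcongr with y
        rw [lintegral_mul_const' _ _ ENNReal.ofReal_ne_top]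
        gcongr
        exact W_int hn y
    _ = _ := by
        rw [lintegral_const_mul' _ _ ENNReal.ofReal_ne_top, ← mul_assoc,
          ← ENNReal.ofReal_mul (by positivity)]
        congr 2; ring

lemma decomp {n : ℕ} (v : EE n) : v = ∑ j, v j • EuclideanSpace.single j (1 : ℝ) := by
  ext i; simp [Finset.sum_apply, Pi.single_apply]

lemma norm_le_sum {n : ℕ} (v : EE n) : ‖v‖ ≤ ∑ j, |v j| := by
  conv_lhs => rw [decomp v]
  refine (norm_sum_le _ _).trans (Finset.sum_le_sum fun j _ => ?_)
  rw [norm_smul]; simp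

lemma opnorm_le_sum {n : ℕ} (L : EE n →L[ℝ] EE n) :
    ‖L‖ ≤ ∑ j, ∑ k, |L (EuclideanSpace.single j (1 : ℝ)) k| := by
  refine ContinuousLinearMap.opNorm_le_bound _ (by positivity) fun v => ?_
  conv_lhs => rw [decomp v]
  rw [map_sum, Finset.sum_mul]
  refine (norm_sum_le _ _).trans (Finset.sum_le_sum fun j _ => ?_)
  rw [map_smul, norm_smul, mul_comm, Real.norm_eq_abs]
  exact mul_le_mul (norm_le_sum _) (abs_coord v j) (abs_nonneg _) (by positivity)

lemma fderiv_coord {n : ℕ} {v : EE n → EE n} {y : EE n} (h : DifferentiableAt ℝ v y) (k : Fin n)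
    (e : EE n) : fderiv ℝ (fun y => v y k) y e = (fderiv ℝ v y e) k := by
  have h1 : HasFDerivAt (fun y => v y k) _ y :=
    (coord_hasFDerivAt k (v y)).comp y h.hasFDerivAt
  rw [h1.fderiv]
  simp

end MazHardy

/-- Maz'ya's inequality. For `n ≥ 2` there is `C > 0` such that for every
`u ∈ C_c^∞(ℝⁿ; ℝⁿ)`, `∫ |Du(x)|/|x| dx ≤ C ∫ (|Δu(x)| + |∇(div u)(x)|) dx`, where `Δ` is the
componentwise Laplacian and `div u = ∑ᵢ ∂ᵢ uᵢ`. -/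
theorem statement16 {n : ℕ} (hn : 2 ≤ n) :
    ∃ C : ℝ, 0 < C ∧
      ∀ u : EuclideanSpace ℝ (Fin n) → EuclideanSpace ℝ (Fin n), IsTestFun u →
        ∫⁻ x, (‖fderiv ℝ u x‖₊ : ℝ≥0∞) / (‖x‖₊ : ℝ≥0∞)
          ≤ ENNReal.ofReal C *
            ∫⁻ x,
              ((‖∑ i : Fin n, fderiv ℝ (fun y => fderiv ℝ u y (EuclideanSpace.single i 1)) x
                  (EuclideanSpace.single i (1 : ℝ))‖₊ : ℝ≥0∞)
                + (‖fderiv ℝ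
                    (fun y => ∑ i : Fin n, fderiv ℝ u y (EuclideanSpace.single i (1 : ℝ)) i)
                    x‖₊ : ℝ≥0∞)) := by
  classical
  set c0 := (∫ z, MazHardy.Ph n z)⁻¹ * (MazHardy.Cn n *
    (7 * (n * (volume.real (Metric.ball (0 : MazHardy.EE n) 1))))) with hc0
  have hc0n : 0 ≤ c0 := by
    have h1 := MazHardy.Ph_int_pos n
    have h2 := MazHardy.Cn_pos n
    positivity
  refine ⟨n * (n * c0) + 1, by positivity, fun u hu => ?_⟩
  obtain ⟨hs, hcs⟩ := hu
  set U : Fin n → MazHardy.EE n → ℝ := fun k y => u y k with hU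
  have hT : ∀ k, MazHardy.Te (U k) := fun k =>
    ⟨(MazHardy.coord_contDiff k).comp hs,
      hcs.comp_left (g := fun z : MazHardy.EE n => z k) (by simp)⟩
  have hdu : Differentiable ℝ u := hs.differentiable (by simp)
  have hD : ∀ j k y, MazHardy.D j (U k) y =
      (fderiv ℝ u y (EuclideanSpace.single j (1 : ℝ))) k := fun j k y =>
    MazHardy.fderiv_coord (hdu y) k _
  have hs1 : ∀ i : Fin n, ContDiff ℝ (⊤ : ℕ∞)
      (fun y => fderiv ℝ u y (EuclideanSpace.single i (1 : ℝ))) := fun i =>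
    (hs.fderiv_right (m := (⊤ : ℕ∞)) (by simp)).clm_apply contDiff_const
  have hlap : ∀ k y, MazHardy.lap (U k) y = (∑ i : Fin n,
      fderiv ℝ (fun y => fderiv ℝ u y (EuclideanSpace.single i 1)) y
        (EuclideanSpace.single i (1 : ℝ))) k := by
    intro k y
    unfold MazHardy.lap
    have : ∀ i : Fin n, MazHardy.D i (MazHardy.D i (U k)) y =
      (fderiv ℝ (fun y => fderiv ℝ u y (EuclideanSpace.single i 1)) y
        (EuclideanSpace.single i (1 : ℝ))) k := by
      intro i
      rw [show MazHardy.D i (U k) = fun y => (fderiv ℝ u y (EuclideanSpace.single i (1 : ℝ))) k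
        from funext fun y => hD i k y]
      exact MazHardy.fderiv_coord ((hs1 i).differentiable (by simp) y) k _
    simp [this]
  have hdv : MazHardy.dv U =
      fun y => ∑ i : Fin n, fderiv ℝ u y (EuclideanSpace.single i (1 : ℝ)) i := by
    ext y
    exact Finset.sum_congr rfl fun i _ => hD i i y
  set f : MazHardy.EE n → MazHardy.EE n := fun x => ∑ i : Fin n,
      fderiv ℝ (fun y => fderiv ℝ u y (EuclideanSpace.single i 1)) x
        (EuclideanSpace.single i (1 : ℝ)) with hf
  rw [← hdv]
  have hfc : Continuous f := by
    refine continuous_finsetSum _ fun i _ => ?_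
    exact (((hs1 i).fderiv_right (m := (⊤ : ℕ∞)) (by simp)).clm_apply contDiff_const).continuous
  have hdc : Continuous (fderiv ℝ (MazHardy.dv U)) :=
    (ContDiff.fderiv_right (m := (⊤ : ℕ∞)) (MazHardy.dv_Te hT).1 (by simp)).continuous
  set G : MazHardy.EE n → ℝ := fun y => ‖f y‖ + ‖fderiv ℝ (MazHardy.dv U) y‖ with hG
  have hGm : Measurable G := (hfc.norm.add hdc.norm).measurable
  have hGb : ∀ y k, |MazHardy.lap (U k) y| + |MazHardy.D k (MazHardy.dv U) y| ≤ G y := by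
    intro y k
    refine add_le_add ?_ ?_
    · rw [hlap]; exact MazHardy.abs_coord _ k
    · have := (fderiv ℝ (MazHardy.dv U) y).le_opNorm (EuclideanSpace.single k (1 : ℝ))
      simpa [MazHardy.D] using this
  have hR : ∀ x, ((‖f x‖₊ : ℝ≥0∞) + (‖fderiv ℝ (MazHardy.dv U) x‖₊ : ℝ≥0∞)) =
      ENNReal.ofReal (G x) := by
    intro x
    rw [hG, ENNReal.ofReal_add (norm_nonneg _) (norm_nonneg _), ofReal_norm, ofReal_norm]
    rfl
  change _ ≤ _ * ∫⁻ x, ((‖f x‖₊ : ℝ≥0∞) + (‖fderiv ℝ (MazHardy.dv U) x‖₊ : ℝ≥0∞))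
  simp_rw [hR]
  have hm : ∀ j k, Measurable fun x : MazHardy.EE n =>
      ENNReal.ofReal |MazHardy.D j (U k) x| / ‖x‖ₑ := fun j k =>
    (((hT k).D j).1.cont.measurable.abs.ennreal_ofReal).div measurable_enorm
  calc ∫⁻ x, (‖fderiv ℝ u x‖₊ : ℝ≥0∞) / (‖x‖₊ : ℝ≥0∞)
      ≤ ∫⁻ x, ∑ j, ∑ k, ENNReal.ofReal |MazHardy.D j (U k) x| / ‖x‖ₑ := by
        refine lintegral_mono fun x => ?_
        have h1 : (‖fderiv ℝ u x‖₊ : ℝ≥0∞) ≤ ∑ j, ∑ k, ENNReal.ofReal |MazHardy.D j (U k) x| := by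
          have h2 : (‖fderiv ℝ u x‖₊ : ℝ≥0∞) = ENNReal.ofReal ‖fderiv ℝ u x‖ :=
            (ofReal_norm _).symm
          have h3 := MazHardy.opnorm_le_sum (fderiv ℝ u x)
          simp_rw [← hD] at h3
          rw [h2]
          refine (ENNReal.ofReal_le_ofReal h3).trans (le_of_eq ?_)
          rw [ENNReal.ofReal_sum_of_nonneg (fun j _ => by positivity)]
          refine Finset.sum_congr rfl fun j _ => ?_
          rw [ENNReal.ofReal_sum_of_nonneg (fun j _ => by positivity)]
        simp only [ENNReal.div_eq_inv_mul, ← Finset.mul_sum]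
        exact mul_le_mul_right h1 _
    _ = ∑ j, ∑ k, ∫⁻ x, ENNReal.ofReal |MazHardy.D j (U k) x| / ‖x‖ₑ := by
        rw [lintegral_finsetSum _ fun j _ => Finset.measurable_fun_sum _ fun k _ => hm j k]
        refine Finset.sum_congr rfl fun j _ => ?_
        rw [lintegral_finsetSum _ fun k _ => hm j k]
    _ ≤ ∑ j : Fin n, ∑ k : Fin n, ENNReal.ofReal c0 * ∫⁻ y, ENNReal.ofReal (G y) :=
        Finset.sum_le_sum fun j _ => Finset.sum_le_sum fun k _ =>
          MazHardy.one_bound hn hT hGm hGb j k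
    _ = ENNReal.ofReal (n * (n * c0)) * ∫⁻ y, ENNReal.ofReal (G y) := by
        rw [ENNReal.ofReal_mul (p := (n : ℝ)) (q := n * c0) (by positivity),
          ENNReal.ofReal_mul (p := (n : ℝ)) (q := c0) (by positivity)]
        simp [mul_assoc]
    _ ≤ _ := by
        gcongr
        linarith
end
end

section
/- Let n ≥ 2. There exists a constant C > 0 such that for every u ∈ C_c^∞(ℝⁿ; ℝⁿ), ∫_{ℝⁿ} |u(x)| / |x| dx ≤ C ∫_{ℝⁿ} |∇^s u(x)| dx, where ∇^s u(x) = (Du(x) + Du(x)^T)/2 is the symmetric part of the derivative. -/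
open MeasureTheory ENNReal
open scoped NNReal RealInnerProductSpace

noncomputable section

section Helpers

variable {E : Type*} [NormedAddCommGroup E] [InnerProductSpace ℝ E]

lemma kh_phi_smooth (w : E) {ε : ℝ} (hε : 0 < ε) :
    ContDiff ℝ (⊤ : ℕ∞) (fun x : E => ⟪w, x⟫ / √(‖x‖ ^ 2 + ε ^ 2)) := by
  have hpos : ∀ x : E, 0 < ‖x‖ ^ 2 + ε ^ 2 := fun x => by positivity
  refine ContDiff.div (contDiff_const.inner ℝ contDiff_id) (ContDiff.sqrt ?_ fun x => (hpos x).ne') fun x => ?_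
  · exact (contDiff_norm_sq ℝ).add contDiff_const
  · exact (Real.sqrt_pos.2 (hpos x)).ne'

lemma kh_phi_deriv (w : E) {ε : ℝ} (hε : 0 < ε) (x : E) :
    fderiv ℝ (fun x : E => ⟪w, x⟫ / √(‖x‖ ^ 2 + ε ^ 2)) x w =
      (‖w‖ ^ 2 * (‖x‖ ^ 2 + ε ^ 2) - ⟪w, x⟫ ^ 2) / √(‖x‖ ^ 2 + ε ^ 2) ^ 3 := by
  have hpos : 0 < ‖x‖ ^ 2 + ε ^ 2 := by positivity
  have hs : 0 < √(‖x‖ ^ 2 + ε ^ 2) := Real.sqrt_pos.2 hpos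
  have hd : DifferentiableAt ℝ (fun x : E => ⟪w, x⟫ / √(‖x‖ ^ 2 + ε ^ 2)) x :=
    (kh_phi_smooth w hε).differentiable (by simp) x
  rw [← hd.lineDeriv_eq_fderiv]
  have h0 : HasDerivAt (fun t : ℝ => x + t • w) w 0 := by
    simpa using ((hasDerivAt_id (0:ℝ)).smul_const w).const_add x
  have h1 : HasDerivAt (fun t : ℝ => ⟪w, x + t • w⟫) ⟪w, w⟫ 0 := by
    simpa using (hasDerivAt_const (0:ℝ) w).inner ℝ h0
  have h2 : HasDerivAt (fun t : ℝ => ‖x + t • w‖ ^ 2 + ε ^ 2) (2 * ⟪x, w⟫) 0 := by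
    simpa using h0.norm_sq.add_const (ε ^ 2)
  have h3 := h2.sqrt (by simpa using hpos.ne')
  have h4 := h1.div h3 (by simpa using hs.ne')
  have h5 : HasLineDerivAt ℝ (fun x : E => ⟪w, x⟫ / √(‖x‖ ^ 2 + ε ^ 2)) _ x w := h4
  rw [h5.lineDeriv]
  simp only [zero_smul, add_zero, real_inner_self_eq_norm_sq, real_inner_comm w x]
  have hsq : √(‖x‖ ^ 2 + ε ^ 2) ^ 2 = ‖x‖ ^ 2 + ε ^ 2 := Real.sq_sqrt hpos.le
  set s := √(‖x‖ ^ 2 + ε ^ 2)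
  rw [← hsq]
  field_simp

lemma kh_g_smooth {h : E → ℝ} (hh : ContDiff ℝ (⊤ : ℕ∞) h) {ε : ℝ} (hε : 0 < ε) :
    ContDiff ℝ (⊤ : ℕ∞) (fun x : E => √(h x ^ 2 + ε ^ 2) - ε) := by
  have hpos : ∀ x : E, h x ^ 2 + ε ^ 2 ≠ 0 := fun x => by positivity
  exact (ContDiff.sqrt ((hh.pow 2).add contDiff_const) hpos).sub contDiff_const

lemma kh_g_deriv {h : E → ℝ} (hh : ContDiff ℝ (⊤ : ℕ∞) h) {ε : ℝ} (hε : 0 < ε) (x w : E) :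
    |fderiv ℝ (fun x : E => √(h x ^ 2 + ε ^ 2) - ε) x w| ≤ |fderiv ℝ h x w| := by
  have hpos : 0 < h x ^ 2 + ε ^ 2 := by positivity
  have h1 : HasFDerivAt h (fderiv ℝ h x) x := (hh.differentiable (by simp) x).hasFDerivAt
  have h2 := (((h1.pow 2).add_const (ε ^ 2)).sqrt hpos.ne').sub_const ε
  rw [h2.fderiv]
  have hs : 0 < √(h x ^ 2 + ε ^ 2) := Real.sqrt_pos.2 hpos
  have hle : |h x| ≤ √(h x ^ 2 + ε ^ 2) := Real.abs_le_sqrt (by nlinarith)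
  simp only [_root_.smul_apply, smul_eq_mul, nsmul_eq_mul]
  have : 1 / (2 * √(h x ^ 2 + ε ^ 2)) * (((2 : ℕ) : ℝ) * h x ^ (2 - 1) * fderiv ℝ h x w)
      = (h x / √(h x ^ 2 + ε ^ 2)) * fderiv ℝ h x w := by
    field_simp; norm_num
  have h3 : |h x / √(h x ^ 2 + ε ^ 2)| ≤ 1 := by
    rw [abs_div, abs_of_pos hs]; exact (div_le_one hs).2 hle
  calc _ = |(h x / √(h x ^ 2 + ε ^ 2)) * fderiv ℝ h x w| := by rw [← this]
    _ ≤ 1 * |fderiv ℝ h x w| := by rw [abs_mul]; gcongr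
    _ = _ := one_mul _

variable [FiniteDimensional ℝ E]

/-- The symmetric gradient. -/
def khSym (u : E → E) (x : E) : E →L[ℝ] E :=
  (2⁻¹ : ℝ) • (fderiv ℝ u x + ContinuousLinearMap.adjoint (fderiv ℝ u x))

lemma kh_sym_bound {u : E → E} (hu : IsTestFun u) (x w : E) :
    |fderiv ℝ (fun x => ⟪w, u x⟫) x w| ≤ ‖w‖ ^ 2 * ‖khSym u x‖ := by
  have hd : DifferentiableAt ℝ u x := hu.1.differentiable (by simp) x
  have h1 : fderiv ℝ (fun x => ⟪w, u x⟫) x w = ⟪w, fderiv ℝ u x w⟫ := by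
    rw [fderiv_inner_apply ℝ (by fun_prop) hd]; simp
  have h2 : ⟪w, khSym u x w⟫ = ⟪w, fderiv ℝ u x w⟫ := by
    simp only [khSym, _root_.smul_apply, _root_.add_apply,
      inner_smul_right, inner_add_right, ContinuousLinearMap.adjoint_inner_right]
    rw [real_inner_comm w (fderiv ℝ u x w)]; ring
  rw [h1, ← h2]
  calc _ ≤ ‖w‖ * ‖khSym u x w‖ := abs_real_inner_le_norm _ _
    _ ≤ ‖w‖ * (‖khSym u x‖ * ‖w‖) := by gcongr; exact ContinuousLinearMap.le_opNorm _ _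
    _ = _ := by ring

variable [MeasurableSpace E] [BorelSpace E]

lemma kh_step {u : E → E} (hu : IsTestFun u) (w : E) {ε : ℝ} (hε : 0 < ε) :
    ∫⁻ x, ENNReal.ofReal ((√(⟪w, u x⟫ ^ 2 + ε ^ 2) - ε) *
      ((‖w‖ ^ 2 * (‖x‖ ^ 2 + ε ^ 2) - ⟪w, x⟫ ^ 2) / √(‖x‖ ^ 2 + ε ^ 2) ^ 3))
    ≤ ENNReal.ofReal (‖w‖ ^ 3) * ∫⁻ x, (‖khSym u x‖₊ : ℝ≥0∞) := by
  have hh : ContDiff ℝ (⊤ : ℕ∞) (fun x => ⟪w, u x⟫) := contDiff_const.inner ℝ hu.1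
  have hgs := kh_g_smooth hh hε
  have hps := kh_phi_smooth w hε
  have hgc : HasCompactSupport (fun x : E => √(⟪w, u x⟫ ^ 2 + ε ^ 2) - ε) := by
    refine hu.2.comp_left (g := fun y : E => √(⟪w, y⟫ ^ 2 + ε ^ 2) - ε) ?_
    simp [Real.sqrt_sq hε.le]
  have hpos : ∀ x : E, 0 < ‖x‖ ^ 2 + ε ^ 2 := fun x => by positivity
  have hnn : ∀ x : E, 0 ≤ (√(⟪w, u x⟫ ^ 2 + ε ^ 2) - ε) *
      ((‖w‖ ^ 2 * (‖x‖ ^ 2 + ε ^ 2) - ⟪w, x⟫ ^ 2) / √(‖x‖ ^ 2 + ε ^ 2) ^ 3) := fun x => by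
    have h1 : ε ≤ √(⟪w, u x⟫ ^ 2 + ε ^ 2) := Real.le_sqrt_of_sq_le (by nlinarith)
    have h2 : ⟪w, x⟫ ^ 2 ≤ ‖w‖ ^ 2 * ‖x‖ ^ 2 := by
      rw [← mul_pow]; exact sq_le_sq' (by linarith [neg_le_of_abs_le (abs_real_inner_le_norm w x)]) (real_inner_le_norm w x)
    refine mul_nonneg (by linarith) (div_nonneg ?_ (by positivity))
    nlinarith [mul_nonneg (sq_nonneg ‖w‖) (sq_nonneg ε)]
  have hphi : ∀ x : E, |⟪w, x⟫ / √(‖x‖ ^ 2 + ε ^ 2)| ≤ ‖w‖ := fun x => by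
    have hs : 0 < √(‖x‖ ^ 2 + ε ^ 2) := Real.sqrt_pos.2 (hpos x)
    rw [abs_div, abs_of_pos hs, div_le_iff₀ hs]
    refine (abs_real_inner_le_norm w x).trans ?_
    gcongr
    exact Real.le_sqrt_of_sq_le (by nlinarith)
  have hcg' : Continuous (fun x : E => fderiv ℝ (fun x : E => √(⟪w, u x⟫ ^ 2 + ε ^ 2) - ε) x w) :=
    (hgs.continuous_fderiv (by simp)).clm_apply continuous_const
  have hcp' : Continuous (fun x : E => fderiv ℝ (fun x : E => ⟪w, x⟫ / √(‖x‖ ^ 2 + ε ^ 2)) x w) :=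
    (hps.continuous_fderiv (by simp)).clm_apply continuous_const
  have i1 := (hcg'.mul hps.continuous).integrable_of_hasCompactSupport (μ := volume)
    ((hgc.fderiv_apply (𝕜 := ℝ) w).mul_right)
  have i2 := (hgs.continuous.mul hcp').integrable_of_hasCompactSupport (μ := volume) hgc.mul_right
  have i3 := (hgs.continuous.mul hps.continuous).integrable_of_hasCompactSupport (μ := volume)
    hgc.mul_right
  have key := integral_mul_fderiv_eq_neg_fderiv_mul_of_integrable i1 i2 i3
    (fun x _ => hgs.differentiable (by simp) x) (fun x _ => hps.differentiable (by simp) x)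
  simp only [kh_phi_deriv w hε] at key i2
  have i2' : Integrable (fun x : E => (√(⟪w, u x⟫ ^ 2 + ε ^ 2) - ε) *
      ((‖w‖ ^ 2 * (‖x‖ ^ 2 + ε ^ 2) - ⟪w, x⟫ ^ 2) / √(‖x‖ ^ 2 + ε ^ 2) ^ 3)) := i2
  rw [← ofReal_integral_eq_lintegral_ofReal i2' (Filter.Eventually.of_forall hnn)]
  have hcu : Continuous (khSym u) := by
    have := hu.1.continuous_fderiv (by simp)
    unfold khSym
    have h2 : Continuous fun x => ContinuousLinearMap.adjoint (fderiv ℝ u x) :=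
      (LinearIsometryEquiv.continuous (ContinuousLinearMap.adjoint (𝕜 := ℝ) (E := E) (F := E))).comp this
    exact (this.add h2).const_smul (2⁻¹ : ℝ)
  have hsc : HasCompactSupport (khSym u) := by
    refine (hu.2.fderiv (𝕜 := ℝ)).comp_left
      (g := fun A : E →L[ℝ] E => (2⁻¹ : ℝ) • (A + ContinuousLinearMap.adjoint A)) ?_
    simp
  have i4 : Integrable (khSym u) := hcu.integrable_of_hasCompactSupport hsc
  have hfin : ∫ x, (√(⟪w, u x⟫ ^ 2 + ε ^ 2) - ε) *
      ((‖w‖ ^ 2 * (‖x‖ ^ 2 + ε ^ 2) - ⟪w, x⟫ ^ 2) / √(‖x‖ ^ 2 + ε ^ 2) ^ 3)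
      ≤ ‖w‖ ^ 3 * ∫ x, ‖khSym u x‖ := by
    rw [key, ← integral_neg, ← integral_const_mul]
    refine integral_mono i1.neg (i4.norm.const_mul _) fun x => ?_
    refine (neg_le_abs _).trans ?_
    rw [abs_mul]
    calc _ ≤ (‖w‖ ^ 2 * ‖khSym u x‖) * ‖w‖ := by
          gcongr
          · exact (kh_g_deriv hh hε x w).trans (kh_sym_bound hu x w)
          · exact hphi x
      _ = _ := by ring
  refine (ENNReal.ofReal_le_ofReal hfin).trans ?_
  rw [ENNReal.ofReal_mul (by positivity), ofReal_integral_norm_eq_lintegral_enorm i4]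
  rfl

lemma kh_dir [Nontrivial E] {u : E → E} (hu : IsTestFun u) (w : E) :
    ∫⁻ x, ENNReal.ofReal (|⟪w, u x⟫| *
      ((‖w‖ ^ 2 * ‖x‖ ^ 2 - ⟪w, x⟫ ^ 2) / ‖x‖ ^ 3))
    ≤ ENNReal.ofReal (‖w‖ ^ 3) * ∫⁻ x, (‖khSym u x‖₊ : ℝ≥0∞) := by
  set F : ℝ → E → ℝ := fun ε x => (√(⟪w, u x⟫ ^ 2 + ε ^ 2) - ε) *
      ((‖w‖ ^ 2 * (‖x‖ ^ 2 + ε ^ 2) - ⟪w, x⟫ ^ 2) / √(‖x‖ ^ 2 + ε ^ 2) ^ 3) with hF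
  let e : ℕ → ℝ := fun k => 1 / ((k : ℝ) + 1)
  have he : ∀ k, 0 < e k := fun k => by positivity
  have he0 : Filter.Tendsto e Filter.atTop (nhds 0) := tendsto_one_div_add_atTop_nhds_zero_nat
  have huc : Continuous u := hu.1.continuous
  have hlim : ∀ x : E, x ≠ 0 → Filter.Tendsto (fun k => ENNReal.ofReal (F (e k) x)) Filter.atTop
      (nhds (ENNReal.ofReal (|⟪w, u x⟫| * ((‖w‖ ^ 2 * ‖x‖ ^ 2 - ⟪w, x⟫ ^ 2) / ‖x‖ ^ 3)))) := by
    intro x hx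
    have hc : ContinuousAt (fun ε : ℝ => F ε x) 0 := by
      simp only [hF]
      refine ContinuousAt.mul (by fun_prop) (ContinuousAt.div (by fun_prop) (by fun_prop) ?_)
      simpa using hx
    have h0 : F 0 x = |⟪w, u x⟫| * ((‖w‖ ^ 2 * ‖x‖ ^ 2 - ⟪w, x⟫ ^ 2) / ‖x‖ ^ 3) := by
      simp [hF, Real.sqrt_sq_eq_abs]
    rw [← h0]
    exact (ENNReal.continuous_ofReal.tendsto _).comp (hc.tendsto.comp he0)
  have hae : ∀ᵐ x : E, x ≠ 0 := by
    simp [ae_iff]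
  calc _ = ∫⁻ x, Filter.liminf (fun k => ENNReal.ofReal (F (e k) x)) Filter.atTop := by
        refine lintegral_congr_ae ?_
        filter_upwards [hae] with x hx
        exact (hlim x hx).liminf_eq.symm
    _ ≤ Filter.liminf (fun k => ∫⁻ x, ENNReal.ofReal (F (e k) x)) Filter.atTop := by
        refine lintegral_liminf_le fun k => ?_
        simp only [hF]
        have := huc.measurable
        fun_prop
    _ ≤ _ := by
        refine Filter.liminf_le_of_le (by isBoundedDefault) fun b hb => ?_
        obtain ⟨k, hk⟩ := hb.exists
        exact hk.trans (kh_step hu w (he k))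

end Helpers

lemma kh_point {a b p q X : ℝ} (hX : 0 < X) (hpq : p ^ 2 + q ^ 2 ≤ X ^ 2) :
    |a| / X ≤ 10 * (|a| * ((1 * X ^ 2 - p ^ 2) / X ^ 3) + |b| * ((1 * X ^ 2 - q ^ 2) / X ^ 3)
      + |a + b| * ((2 * X ^ 2 - (p + q) ^ 2) / X ^ 3)) := by
  have e1 : |a| / X = |a| * X ^ 2 / X ^ 3 := by field_simp
  have e2 : 10 * (|a| * ((1 * X ^ 2 - p ^ 2) / X ^ 3) + |b| * ((1 * X ^ 2 - q ^ 2) / X ^ 3)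
      + |a + b| * ((2 * X ^ 2 - (p + q) ^ 2) / X ^ 3)) =
      (10 * (|a| * (X ^ 2 - p ^ 2) + |b| * (X ^ 2 - q ^ 2)
      + |a + b| * (2 * X ^ 2 - (p + q) ^ 2))) / X ^ 3 := by field_simp
  rw [e1, e2]
  refine div_le_div_of_nonneg_right ?_ (by positivity)
  have ha := abs_nonneg a
  have hb := abs_nonneg b
  have hab := abs_nonneg (a + b)
  have hp : 0 ≤ X ^ 2 - p ^ 2 := by nlinarith
  have hq : 0 ≤ X ^ 2 - q ^ 2 := by nlinarith
  have hs : 0 ≤ 2 * X ^ 2 - (p + q) ^ 2 := by nlinarith [sq_nonneg (p - q)]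
  have t1 := mul_nonneg ha hp
  have t2 := mul_nonneg hb hq
  have t3 := mul_nonneg hab hs
  by_cases hc : X ^ 2 ≤ 10 * (X ^ 2 - p ^ 2)
  · nlinarith [mul_le_mul_of_nonneg_left hc ha]
  · have hq2 : X ^ 2 ≤ 10 * (X ^ 2 - q ^ 2) := by nlinarith
    have hs2 : X ^ 2 ≤ 10 * (2 * X ^ 2 - (p + q) ^ 2) := by
      nlinarith [sq_nonneg (p - 3 * q)]
    have tri : |a| ≤ |a + b| + |b| := by
      simpa using abs_sub (a + b) b
    nlinarith [mul_le_mul_of_nonneg_left hq2 hb, mul_le_mul_of_nonneg_left hs2 hab,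
      mul_le_mul_of_nonneg_right tri (sq_nonneg X)]

/-- Korn–Hardy inequality. For `n ≥ 2` there is `C > 0` such that for
every `u ∈ C_c^∞(ℝⁿ; ℝⁿ)`, `∫ |u(x)|/|x| dx ≤ C ∫ |∇^s u(x)| dx`, where
`∇^s u(x) = (Du(x) + Du(x)^T)/2` is the symmetric derivative (the transpose being the
adjoint of `Du(x)`). -/
theorem statement17 {n : ℕ} (hn : 2 ≤ n) :
    ∃ C : ℝ, 0 < C ∧
      ∀ u : EuclideanSpace ℝ (Fin n) → EuclideanSpace ℝ (Fin n), IsTestFun u →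
        ∫⁻ x, (‖u x‖₊ : ℝ≥0∞) / (‖x‖₊ : ℝ≥0∞)
          ≤ ENNReal.ofReal C *
            ∫⁻ x, (‖(2⁻¹ : ℝ) •
              (fderiv ℝ u x + ContinuousLinearMap.adjoint (fderiv ℝ u x))‖₊ : ℝ≥0∞) := by
  have : Nontrivial (Fin n) := Fin.nontrivial_iff_two_le.2 hn
  have : Nonempty (Fin n) := ⟨⟨0, by omega⟩⟩
  choose j hj using fun k : Fin n => exists_ne k
  let v : Fin n → EuclideanSpace ℝ (Fin n) := fun k => EuclideanSpace.single k (1 : ℝ)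
  let D : Fin n → ℝ := fun k => ‖v k‖ ^ 3 + ‖v (j k)‖ ^ 3 + ‖v k + v (j k)‖ ^ 3
  have hv : ∀ k, ‖v k‖ = 1 := fun k => by simp [v]
  have hin : ∀ k (y : EuclideanSpace ℝ (Fin n)), ⟪v k, y⟫ = y k := fun k y => by
    simp only [v]; rw [EuclideanSpace.inner_single_left]; simp
  have hv2 : ∀ k, ‖v k + v (j k)‖ ^ 2 = 2 := fun k => by
    rw [norm_add_sq_real, hv, hv, hin]
    simp [v, (hj k).symm]; norm_num
  refine ⟨∑ k, 10 * D k, ?_, fun u hu => ?_⟩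
  · refine Finset.sum_pos (fun k _ => ?_) Finset.univ_nonempty
    have : 0 ≤ ‖v k + v (j k)‖ ^ 3 := by positivity
    simp only [D, hv]; linarith
  change _ ≤ _ * ∫⁻ x, (‖khSym u x‖₊ : ℝ≥0∞)
  let G : EuclideanSpace ℝ (Fin n) → EuclideanSpace ℝ (Fin n) → ℝ := fun w x => |⟪w, u x⟫| * ((‖w‖ ^ 2 * ‖x‖ ^ 2 - ⟪w, x⟫ ^ 2) / ‖x‖ ^ 3)
  have hG : ∀ w x, 0 ≤ G w x := fun w x => by
    refine mul_nonneg (abs_nonneg _) (div_nonneg ?_ (by positivity))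
    rw [← mul_pow, sub_nonneg, sq_le_sq, abs_of_nonneg (a := ‖w‖ * ‖x‖) (by positivity)]
    exact abs_real_inner_le_norm w x
  have huc : Continuous u := hu.1.continuous
  have hGm : ∀ w, Measurable (fun x => ENNReal.ofReal (G w x)) := fun w => by
    have := huc.measurable
    simp only [G]
    fun_prop
  have hae : ∀ᵐ x : EuclideanSpace ℝ (Fin n), x ≠ 0 := by simp [ae_iff]
  have hpt : ∀ x : EuclideanSpace ℝ (Fin n), x ≠ 0 → (‖u x‖₊ : ℝ≥0∞) / (‖x‖₊ : ℝ≥0∞) ≤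
      ∑ k, ENNReal.ofReal 10 * (ENNReal.ofReal (G (v k) x) + ENNReal.ofReal (G (v (j k)) x)
        + ENNReal.ofReal (G (v k + v (j k)) x)) := by
    intro x hx
    have hX : 0 < ‖x‖ := norm_pos_iff.2 hx
    have h1 : (‖u x‖₊ : ℝ≥0∞) / (‖x‖₊ : ℝ≥0∞) = ENNReal.ofReal (‖u x‖ / ‖x‖) := by
      rw [ENNReal.ofReal_div_of_pos hX, ofReal_norm, ofReal_norm]; rfl
    have h2 : ∀ k, ENNReal.ofReal 10 * (ENNReal.ofReal (G (v k) x)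
        + ENNReal.ofReal (G (v (j k)) x) + ENNReal.ofReal (G (v k + v (j k)) x))
        = ENNReal.ofReal (10 * (G (v k) x + G (v (j k)) x + G (v k + v (j k)) x)) := fun k => by
      rw [ENNReal.ofReal_mul (p := 10) (by norm_num), ENNReal.ofReal_add (add_nonneg (hG _ _) (hG _ _)) (hG _ _),
        ENNReal.ofReal_add (hG _ _) (hG _ _)]
    rw [h1, Finset.sum_congr rfl fun k _ => h2 k, ← ENNReal.ofReal_sum_of_nonneg]
    · refine ENNReal.ofReal_le_ofReal ?_
      have h3 : ‖u x‖ ≤ ∑ k, |u x k| := by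
        have := norm_sum_le Finset.univ (fun k => (u x k) • v k)
        have h4 : ∑ k, (u x k) • v k = u x := by
          ext i; simp [v, Finset.sum_apply, Pi.single_apply]
        rw [h4] at this
        simpa [norm_smul, hv] using this
      calc _ ≤ (∑ k, |u x k|) / ‖x‖ := by gcongr
        _ = ∑ k, |u x k| / ‖x‖ := Finset.sum_div _ _ _
        _ ≤ _ := by
          refine Finset.sum_le_sum fun k _ => ?_
          have h5 : (x k) ^ 2 + (x (j k)) ^ 2 ≤ ‖x‖ ^ 2 := by
            rw [EuclideanSpace.real_norm_sq_eq, ← Finset.sum_pair (f := fun i => x i ^ 2) (hj k).symm]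
            exact Finset.sum_le_sum_of_subset_of_nonneg (Finset.subset_univ _)
              fun i _ _ => sq_nonneg _
          have := kh_point (a := u x k) (b := u x (j k)) hX h5
          simpa only [G, inner_add_left, hin, hv, hv2, one_pow] using this
    · intro k _
      have := hG (v k) x
      have := hG (v (j k)) x
      have := hG (v k + v (j k)) x
      linarith
  calc _ ≤ ∫⁻ x, ∑ k, ENNReal.ofReal 10 * (ENNReal.ofReal (G (v k) x)
        + ENNReal.ofReal (G (v (j k)) x) + ENNReal.ofReal (G (v k + v (j k)) x)) := by
        refine lintegral_mono_ae ?_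
        filter_upwards [hae] with x hx using hpt x hx
    _ = ∑ k, ENNReal.ofReal 10 * ((∫⁻ x, ENNReal.ofReal (G (v k) x))
        + (∫⁻ x, ENNReal.ofReal (G (v (j k)) x)) + ∫⁻ x, ENNReal.ofReal (G (v k + v (j k)) x)) := by
        rw [lintegral_finsetSum]
        · refine Finset.sum_congr rfl fun k _ => ?_
          rw [lintegral_const_mul, lintegral_add_left, lintegral_add_left]
          · exact hGm _
          · exact (hGm _).add (hGm _)
          · exact ((hGm _).add (hGm _)).add (hGm _)
        · exact fun k _ => (((hGm _).add (hGm _)).add (hGm _)).const_mul _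
    _ ≤ ∑ k, ENNReal.ofReal (10 * D k) * ∫⁻ x, (‖khSym u x‖₊ : ℝ≥0∞) := by
        refine Finset.sum_le_sum fun k _ => ?_
        rw [ENNReal.ofReal_mul (by norm_num), mul_assoc]
        refine mul_le_mul_right ?_ _
        simp only [D]
        rw [ENNReal.ofReal_add (by positivity) (by positivity),
          ENNReal.ofReal_add (by positivity) (by positivity), add_mul, add_mul]
        exact add_le_add (add_le_add (kh_dir hu _) (kh_dir hu _)) (kh_dir hu _)
    _ = _ := by
        rw [← Finset.sum_mul, ENNReal.ofReal_sum_of_nonneg]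
        intro k _
        positivity
end
end
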